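/- arXiv:1409.0944 — 5 statements merged into one kernel-verified Lean document; each statement's English description precedes it below -/
import Mathlib

section
/- Let 0<α<2, c>0, s(y)=c·|y|^{-(1+α)} for y≠0, and fix p with 0 ≤ p < (1+α)/2. Then there exist a constant C>0 and natural numbers k,m such that for every Schwartz function H:ℝ→ℝ, sup_{x∈ℝ} (1+x²)^p·|Δ^{α/2}H(x)| ≤ C · max_{i≤k, j≤m} sup_{x∈ℝ} |x|^i·|H^{(j)}(x)|, where H^{(j)} denotes the j-th derivative. In other words, H ↦ Δ^{α/2}H is a continuous linear map from the Schwartz space (with its seminorm topology) to the Banach space of continuous functions with finite weighted sup-norm sup_x (1+x²)^p|φ(x)|. -/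
open MeasureTheory

/-- The fractional Laplacian of `H` with kernel `s y = c * |y| ^ (-(1+α))`
(the integrand vanishes at `y = 0` since `0 ^ (-(1+α)) = 0`). -/
noncomputable def fracLap (α c : ℝ) (H : ℝ → ℝ) (x : ℝ) : ℝ :=
  (1 / 2) * ∫ y : ℝ, c * |y| ^ (-(1 + α)) * (H (x + y) - 2 * H x + H (x - y))

/-- The function `|y| ^ (1-α)` near the origin, `|y| ^ (-(1+α))` away from it; it dominates
second differences weighted by the kernel. -/
noncomputable def kernelMajorant (α y : ℝ) : ℝ :=
  |y| ^ (-(1 + α)) * min (y ^ 2) 1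

/-- A function of `|x|` is integrable as soon as it is integrable on the positive half-line. -/
lemma integrable_comp_abs_of_integrableOn_Ioi {f : ℝ → ℝ}
    (hf : IntegrableOn (fun x => f |x|) (Set.Ioi 0)) : Integrable (fun x => f |x|) := by
  have h : IntegrableOn (fun x => f |x|) (Set.Iic 0) := by
    rw [← Measure.map_neg_eq_self (volume : Measure ℝ)]
    let m : MeasurableEmbedding fun x : ℝ => -x := (Homeomorph.neg ℝ).measurableEmbedding
    rw [m.integrableOn_map_iff]
    simp_rw [Function.comp_def, abs_neg, Set.neg_preimage, Set.neg_Iic, neg_zero]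
    exact Iff.mpr integrableOn_Ici_iff_integrableOn_Ioi hf
  rw [← integrableOn_univ, ← Set.Iic_union_Ioi (a := (0 : ℝ))]
  exact h.union hf

lemma integrable_kernelMajorant {α : ℝ} (hα0 : 0 < α) (hα2 : α < 2) :
    Integrable (kernelMajorant α) := by
  have key : Integrable (fun y : ℝ => (fun t : ℝ => t ^ (-(1 + α)) * min (t ^ 2) 1) |y|) := by
    apply integrable_comp_abs_of_integrableOn_Ioi
      (f := fun t : ℝ => t ^ (-(1 + α)) * min (t ^ 2) 1)
    rw [← Set.Ioc_union_Ioi_eq_Ioi (zero_le_one (α := ℝ))]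
    refine IntegrableOn.union ?_ ?_
    · have h := (intervalIntegral.intervalIntegrable_rpow' (a := 0) (b := 1)
        (show -1 < 1 - α by linarith))
      rw [intervalIntegrable_iff_integrableOn_Ioc_of_le zero_le_one] at h
      refine h.congr_fun (fun t ht => ?_) measurableSet_Ioc
      have h0 : 0 < t := ht.1
      have h1 : t ^ 2 ≤ 1 := pow_le_one₀ h0.le ht.2
      simp only [abs_of_pos h0, min_eq_left h1]
      rw [← Real.rpow_natCast t 2, ← Real.rpow_add h0]
      congr 1
      push_cast
      ring
    · refine (integrableOn_Ioi_rpow_of_lt (show -(1 + α) < -1 by linarith)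
        zero_lt_one).congr_fun (fun t ht => ?_) measurableSet_Ioi
      have h0 : 1 < t := ht
      have h1 : 1 ≤ t ^ 2 := one_le_pow₀ h0.le
      simp only [abs_of_pos (zero_lt_one.trans h0), min_eq_right h1, mul_one]
  refine key.congr (Filter.Eventually.of_forall fun y => ?_)
  simp [kernelMajorant]

lemma kernelMajorant_nonneg (α y : ℝ) : 0 ≤ kernelMajorant α y := by
  unfold kernelMajorant
  positivity

/-- A second difference is controlled by the second derivative. -/
lemma abs_second_difference_le {f f' f'' : ℝ → ℝ} (hf : ∀ z, HasDerivAt f (f' z) z)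
    (hf' : ∀ z, HasDerivAt f' (f'' z) z) {x y B : ℝ}
    (hB : ∀ z, |z - x| ≤ |y| → |f'' z| ≤ B) :
    |f (x + y) - 2 * f x + f (x - y)| ≤ 2 * B * y ^ 2 := by
  have hB0 : 0 ≤ B := (abs_nonneg _).trans (hB x (by simp))
  have h1 : ∀ t ∈ Set.Icc (-|y|) |y|, ‖f' (x + t) - f' (x - t)‖ ≤ 2 * B * |y| := by
    intro t ht
    have hs : Convex ℝ (Set.Icc (x - |y|) (x + |y|)) := convex_Icc _ _
    have := hs.norm_image_sub_le_of_norm_hasDerivWithin_le (f := f') (f' := f'') (C := B)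
      (x := x - t) (y := x + t)
      (fun z _ => (hf' z).hasDerivWithinAt)
      (fun z hz => hB z (abs_le.2 ⟨by linarith [hz.1], by linarith [hz.2]⟩))
      ⟨by linarith [ht.2], by linarith [ht.1]⟩ ⟨by linarith [ht.1], by linarith [ht.2]⟩
    refine this.trans ?_
    have e : ‖x + t - (x - t)‖ = 2 * |t| := by
      rw [show x + t - (x - t) = 2 * t by ring, Real.norm_eq_abs, abs_mul]
      norm_num
    rw [e]
    have : |t| ≤ |y| := abs_le.2 ht
    nlinarith
  have h2 : ∀ t ∈ Set.Icc (-|y|) |y|, HasDerivWithinAt (fun t => f (x + t) + f (x - t))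
      (f' (x + t) - f' (x - t)) (Set.Icc (-|y|) |y|) t := by
    intro t _
    have := ((hf (x + t)).comp_const_add x t).add ((hf (x - t)).comp_const_sub x t)
    exact (this.congr_deriv (by ring)).hasDerivWithinAt
  have h3 := (convex_Icc (-|y|) |y|).norm_image_sub_le_of_norm_hasDerivWithin_le h2 h1
    (x := 0) (y := y) ⟨by simp, by simp⟩ ⟨neg_abs_le y, le_abs_self y⟩
  simp only [add_zero, sub_zero, Real.norm_eq_abs] at h3
  calc |f (x + y) - 2 * f x + f (x - y)| = |f (x + y) + f (x - y) - (f x + f x)| := by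
        congr 1; ring
    _ ≤ _ := h3
    _ = 2 * B * y ^ 2 := by rw [mul_assoc (2 * B), ← sq, sq_abs]

/-- The weighted second difference is pointwise dominated, uniformly in the weight. -/
lemma weighted_second_difference_le {α : ℝ} (hα0 : 0 < α) (hα2 : α < 2)
    {f f' f'' : ℝ → ℝ} (hf : ∀ z, HasDerivAt f (f' z) z)
    (hf' : ∀ z, HasDerivAt f' (f'' z) z) {M : ℝ}
    (h0 : ∀ z, (1 + |z|) ^ 5 * |f z| ≤ M) (h2 : ∀ z, (1 + |z|) ^ 5 * |f'' z| ≤ M)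
    (x : ℝ) {y : ℝ} (hy : y ≠ 0) :
    (1 + |x|) ^ (1 + α) * (|y| ^ (-(1 + α)) * |f (x + y) - 2 * f x + f (x - y)|) ≤
      64 * M * (kernelMajorant α y + (1 + (x + y) ^ 2)⁻¹ + (1 + (x - y) ^ 2)⁻¹) := by
  set A := 1 + |x| with hA
  have hA1 : 1 ≤ A := by linarith [abs_nonneg x]
  have hA0 : 0 < A := by linarith
  have hM : 0 ≤ M := le_trans (by positivity) (h0 0)
  have hy0 : 0 < |y| := abs_pos.2 hy
  have hW : A ^ (1 + α) ≤ A ^ 3 := by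
    rw [← Real.rpow_natCast A 3]
    exact Real.rpow_le_rpow_of_exponent_le hA1 (by push_cast; linarith)
  have hW0 : 0 ≤ A ^ (1 + α) := by positivity
  have hK0 : 0 ≤ |y| ^ (-(1 + α)) := by positivity
  have hi1 : 0 ≤ (1 + (x + y) ^ 2)⁻¹ := by positivity
  have hi2 : 0 ≤ (1 + (x - y) ^ 2)⁻¹ := by positivity
  by_cases hnear : |y| ≤ max 1 (A / 2)
  · have hB : ∀ z, |z - x| ≤ |y| → |f'' z| ≤ 32 * M / A ^ 5 := by
      intro z hz
      have hAz : A ≤ 2 * (1 + |z|) := by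
        have t1 : |x| ≤ |z| + |z - x| := by
          rw [abs_sub_comm]
          linarith [abs_sub_abs_le_abs_sub x z]
        rcases le_max_iff.1 hnear with h | h
        · linarith [abs_nonneg z]
        · linarith [abs_nonneg z]
      rw [le_div_iff₀ (by positivity)]
      calc |f'' z| * A ^ 5 ≤ |f'' z| * (2 * (1 + |z|)) ^ 5 := by gcongr
        _ = 32 * ((1 + |z|) ^ 5 * |f'' z|) := by ring
        _ ≤ 32 * M := by linarith [h2 z]
    have hd := abs_second_difference_le hf hf' hB
    have hmin : A ^ 3 * y ^ 2 ≤ A ^ 5 * min (y ^ 2) 1 := by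
      rcases le_total (y ^ 2) 1 with h | h
      · rw [min_eq_left h]
        gcongr
        · norm_num
      · rw [min_eq_right h]
        have hyA : |y| ≤ A := by
          rcases le_max_iff.1 hnear with h | h <;> linarith
        have : y ^ 2 ≤ A ^ 2 := by
          rw [← sq_abs]; gcongr
        calc A ^ 3 * y ^ 2 ≤ A ^ 3 * A ^ 2 := by gcongr
          _ = A ^ 5 * 1 := by ring
    calc A ^ (1 + α) * (|y| ^ (-(1 + α)) * |f (x + y) - 2 * f x + f (x - y)|)
        ≤ A ^ 3 * (|y| ^ (-(1 + α)) * (2 * (32 * M / A ^ 5) * y ^ 2)) := by gcongr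
      _ = 64 * M / A ^ 5 * |y| ^ (-(1 + α)) * (A ^ 3 * y ^ 2) := by ring
      _ ≤ 64 * M / A ^ 5 * |y| ^ (-(1 + α)) * (A ^ 5 * min (y ^ 2) 1) := by gcongr
      _ = 64 * M * kernelMajorant α y := by
        unfold kernelMajorant
        field_simp
      _ ≤ _ := by
        apply mul_le_mul_of_nonneg_left _ (by positivity)
        linarith
  · push Not at hnear
    obtain ⟨hy1, hyA⟩ := max_lt_iff.1 hnear
    have hkm : kernelMajorant α y = |y| ^ (-(1 + α)) := by
      rw [kernelMajorant, min_eq_right, mul_one]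
      rw [← sq_abs]
      exact one_le_pow₀ hy1.le
    have hWK : A ^ (1 + α) * |y| ^ (-(1 + α)) ≤ 8 := by
      rw [Real.rpow_neg hy0.le, ← div_eq_mul_inv, ← Real.div_rpow hA0.le hy0.le]
      have h8 : A / |y| ≤ 2 := by rw [div_le_iff₀ hy0]; linarith
      calc (A / |y|) ^ (1 + α) ≤ 2 ^ (1 + α) := by gcongr
        _ ≤ (2 : ℝ) ^ (3 : ℝ) := Real.rpow_le_rpow_of_exponent_le (by norm_num) (by linarith)
        _ = 8 := by norm_num
    have hfz : ∀ z, |f z| ≤ M * (1 + z ^ 2)⁻¹ := by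
      intro z
      rw [← div_eq_mul_inv, le_div_iff₀ (by positivity), mul_comm]
      refine le_trans ?_ (h0 z)
      gcongr
      have hz := abs_nonneg z
      calc 1 + z ^ 2 = 1 + |z| ^ 2 := by rw [sq_abs]
        _ ≤ (1 + |z|) ^ 2 := by nlinarith
        _ ≤ (1 + |z|) ^ 5 := pow_le_pow_right₀ (by linarith) (by norm_num)
    have hWf : A ^ (1 + α) * |f x| ≤ M := by
      refine le_trans ?_ (h0 x)
      gcongr
      exact hW.trans (pow_le_pow_right₀ hA1 (by norm_num))
    have htri : |f (x + y) - 2 * f x + f (x - y)| ≤ |f (x + y)| + 2 * |f x| + |f (x - y)| := by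
      calc _ ≤ |f (x + y) - 2 * f x| + |f (x - y)| := abs_add_le _ _
        _ ≤ |f (x + y)| + |2 * f x| + |f (x - y)| := by gcongr; exact abs_sub _ _
        _ = _ := by rw [abs_mul]; norm_num
    rw [hkm]
    calc A ^ (1 + α) * (|y| ^ (-(1 + α)) * |f (x + y) - 2 * f x + f (x - y)|)
        ≤ A ^ (1 + α) * (|y| ^ (-(1 + α)) * (|f (x + y)| + 2 * |f x| + |f (x - y)|)) := by
          gcongr
      _ = A ^ (1 + α) * |y| ^ (-(1 + α)) * (|f (x + y)| + |f (x - y)|) +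
            2 * |y| ^ (-(1 + α)) * (A ^ (1 + α) * |f x|) := by ring
      _ ≤ 8 * (M * (1 + (x + y) ^ 2)⁻¹ + M * (1 + (x - y) ^ 2)⁻¹) +
            2 * |y| ^ (-(1 + α)) * M := by
          gcongr
          · exact hfz _
          · exact hfz _
      _ ≤ _ := by
          have e1 := mul_nonneg hM hi1
          have e2 := mul_nonneg hM hi2
          have e3 := mul_nonneg hM hK0
          linarith

/-- The weighted fractional Laplacian is bounded by the decay of the function and of its second
derivative. -/
lemma weighted_fracLap_le {α c : ℝ} (hα0 : 0 < α) (hα2 : α < 2) (hc : 0 < c)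
    {f f' f'' : ℝ → ℝ} (hf : ∀ z, HasDerivAt f (f' z) z)
    (hf' : ∀ z, HasDerivAt f' (f'' z) z) {M : ℝ}
    (h0 : ∀ z, (1 + |z|) ^ 5 * |f z| ≤ M) (h2 : ∀ z, (1 + |z|) ^ 5 * |f'' z| ≤ M) (x : ℝ) :
    (1 + |x|) ^ (1 + α) * |fracLap α c f x| ≤
      32 * c * M * ((∫ y, kernelMajorant α y) + 2 * Real.pi) := by
  have hA0 : 0 < 1 + |x| := by positivity
  have hW : 0 < (1 + |x|) ^ (1 + α) := by positivity
  have i1 := integrable_kernelMajorant hα0 hα2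
  have i2 : Integrable (fun y : ℝ => (1 + (x + y) ^ 2)⁻¹) :=
    integrable_inv_one_add_sq.comp_add_left x
  have i3 : Integrable (fun y : ℝ => (1 + (x - y) ^ 2)⁻¹) :=
    integrable_inv_one_add_sq.comp_sub_left x
  have i12 : Integrable (fun y : ℝ => kernelMajorant α y + (1 + (x + y) ^ 2)⁻¹) := i1.add i2
  have e2 : ∫ y : ℝ, (1 + (x + y) ^ 2)⁻¹ = Real.pi := by
    rw [integral_add_left_eq_self (fun y : ℝ => (1 + y ^ 2)⁻¹) x, integral_univ_inv_one_add_sq]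
  have e3 : ∫ y : ℝ, (1 + (x - y) ^ 2)⁻¹ = Real.pi := by
    rw [integral_sub_left_eq_self (fun y : ℝ => (1 + y ^ 2)⁻¹) volume x,
      integral_univ_inv_one_add_sq]
  have hb := norm_integral_le_of_norm_le
    (f := fun y : ℝ => (1 + |x|) ^ (1 + α) *
      (c * |y| ^ (-(1 + α)) * (f (x + y) - 2 * f x + f (x - y))))
    ((i12.add i3).const_mul (c * (64 * M))) (by
      have hne : ∀ᵐ y : ℝ, y ≠ 0 := by simp [ae_iff]
      filter_upwards [hne] with y hy
      have h := weighted_second_difference_le hα0 hα2 hf hf' h0 h2 x hy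
      rw [Real.norm_eq_abs, abs_mul, abs_mul, abs_mul, abs_of_pos hW, abs_of_pos hc,
        abs_of_nonneg (by positivity : 0 ≤ |y| ^ (-(1 + α)))]
      have h' := mul_le_mul_of_nonneg_left h hc.le
      simp only [Pi.add_apply]
      linarith)
  rw [integral_const_mul, integral_const_mul, integral_add' i12 i3, integral_add i1 i2, e2, e3,
    norm_mul, Real.norm_of_nonneg hW.le, Real.norm_eq_abs] at hb
  rw [fracLap, abs_mul, abs_of_pos (by norm_num : (0 : ℝ) < 1 / 2)]
  linarith

lemma SchwartzMap.bddAbove_range_pow_mul_iteratedDeriv (H : SchwartzMap ℝ ℝ) (i j : ℕ) :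
    BddAbove (Set.range fun y : ℝ => |y| ^ i * |iteratedDeriv j (⇑H) y|) := by
  obtain ⟨C, -, hC⟩ := H.decay i j
  refine ⟨C, ?_⟩
  rintro _ ⟨y, rfl⟩
  have := hC y
  rwa [norm_iteratedFDeriv_eq_norm_iteratedDeriv, Real.norm_eq_abs, Real.norm_eq_abs] at this

lemma SchwartzMap.pow_mul_iteratedDeriv_le_iSup (H : SchwartzMap ℝ ℝ) {k m : ℕ}
    (i : Fin (k + 1)) (j : Fin (m + 1)) (y : ℝ) :
    |y| ^ (i : ℕ) * |iteratedDeriv (j : ℕ) (⇑H) y| ≤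
      ⨆ (i : Fin (k + 1)) (j : Fin (m + 1)) (y : ℝ),
        |y| ^ (i : ℕ) * |iteratedDeriv (j : ℕ) (⇑H) y| :=
  (le_ciSup (H.bddAbove_range_pow_mul_iteratedDeriv i j) y).trans <|
    (le_ciSup (f := fun j : Fin (m + 1) => ⨆ y : ℝ, |y| ^ (i : ℕ) * |iteratedDeriv j (⇑H) y|)
      (Set.finite_range _).bddAbove j).trans <|
    le_ciSup (f := fun i : Fin (k + 1) => ⨆ (j : Fin (m + 1)) (y : ℝ),
      |y| ^ (i : ℕ) * |iteratedDeriv j (⇑H) y|) (Set.finite_range _).bddAbove i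

/-- For `0 < α < 2`, `c > 0` and `0 ≤ p < (1+α)/2`, there are a
constant `C > 0` and naturals `k, m` such that for every Schwartz `H`,
`sup_x (1+x²)^p |Δ^{α/2}H(x)| ≤ C · max_{i ≤ k, j ≤ m} sup_x |x|^i |H^{(j)}(x)|`;
i.e. `Δ^{α/2}` is continuous from Schwartz space to the weighted sup-norm space. -/
theorem fracLap_continuous_schwartz_to_weighted
    (α c p : ℝ) (hα0 : 0 < α) (hα2 : α < 2) (hc : 0 < c)
    (hp0 : 0 ≤ p) (hp : p < (1 + α) / 2) :
    ∃ (C : ℝ) (k m : ℕ), 0 < C ∧ ∀ H : SchwartzMap ℝ ℝ, ∀ x : ℝ,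
      (1 + x ^ 2) ^ p * |fracLap α c ⇑H x| ≤
        C * ⨆ (i : Fin (k + 1)) (j : Fin (m + 1)) (y : ℝ),
              |y| ^ (i : ℕ) * |iteratedDeriv (j : ℕ) (⇑H) y| := by
  have hI : 0 ≤ ∫ y, kernelMajorant α y := integral_nonneg (kernelMajorant_nonneg α)
  have hpi := Real.pi_pos
  refine ⟨32 * c * 32 * ((∫ y, kernelMajorant α y) + 2 * Real.pi), 5, 2, by positivity, ?_⟩
  intro H x
  set M := ⨆ (i : Fin (5 + 1)) (j : Fin (2 + 1)) (y : ℝ),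
    |y| ^ (i : ℕ) * |iteratedDeriv (j : ℕ) (⇑H) y| with hM
  have hdecay (j : Fin 3) (z : ℝ) : (1 + |z|) ^ 5 * |iteratedDeriv j (⇑H) z| ≤ 32 * M := by
    have h0 := H.pow_mul_iteratedDeriv_le_iSup (k := 5) (m := 2) 0 j z
    have h5 := H.pow_mul_iteratedDeriv_le_iSup (k := 5) (m := 2) 5 j z
    rw [← hM] at h0 h5
    have hpow : (1 + |z|) ^ 5 ≤ 2 ^ 4 * (1 ^ 5 + |z| ^ 5) :=
      add_pow_le zero_le_one (abs_nonneg z) 5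
    have h5' : |z| ^ 5 * |iteratedDeriv j (⇑H) z| ≤ M := h5
    have h0' : |z| ^ 0 * |iteratedDeriv j (⇑H) z| ≤ M := h0
    calc (1 + |z|) ^ 5 * |iteratedDeriv j (⇑H) z|
        ≤ 2 ^ 4 * (1 ^ 5 + |z| ^ 5) * |iteratedDeriv j (⇑H) z| := by gcongr
      _ = 16 * (|z| ^ 0 * |iteratedDeriv j (⇑H) z|) +
            16 * (|z| ^ 5 * |iteratedDeriv j (⇑H) z|) := by ring
      _ ≤ 32 * M := by linarith
  have hderiv (j : ℕ) (z : ℝ) :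
      HasDerivAt (iteratedDeriv j ⇑H) (iteratedDeriv (j + 1) (⇑H) z) z := by
    rw [iteratedDeriv_succ]
    exact ((H.smooth (j + 1 : ℕ)).differentiable_iteratedDeriv j
      (by exact_mod_cast Nat.lt_succ_self j) z).hasDerivAt
  have hd0 := hderiv 0
  have hb0 := hdecay 0
  simp only [Fin.val_zero, iteratedDeriv_zero] at hd0 hb0
  have hmain := weighted_fracLap_le hα0 hα2 hc hd0 (hderiv 1) hb0 (hdecay 2) x
  have hweight : (1 + x ^ 2) ^ p ≤ (1 + |x|) ^ (1 + α) := by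
    have hx := abs_nonneg x
    calc (1 + x ^ 2) ^ p ≤ ((1 + |x|) ^ 2) ^ p := by
          gcongr
          rw [← sq_abs]
          nlinarith
      _ = (1 + |x|) ^ (2 * p) := by
          rw [← Real.rpow_natCast (1 + |x|) 2, ← Real.rpow_mul (by positivity)]
          norm_num
      _ ≤ (1 + |x|) ^ (1 + α) :=
          Real.rpow_le_rpow_of_exponent_le (by linarith) (by linarith)
  calc (1 + x ^ 2) ^ p * |fracLap α c ⇑H x|
      ≤ (1 + |x|) ^ (1 + α) * |fracLap α c ⇑H x| := by gcongr
    _ ≤ 32 * c * (32 * M) * ((∫ y, kernelMajorant α y) + 2 * Real.pi) := hmain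
    _ = _ := by ring
end

section
/- Let 0<α<2, c>0, s(y)=c·|y|^{-(1+α)} for y≠0, let H:ℝ→ℝ be a Schwartz function, and fix u∈ℝ. Then lim_{n→∞} (1/(2·n^{1/α}))·∑_{y∈ℤ∖{0}} s(y/n^{1/α})·( H(u + y/n^{1/α}) + H(u − y/n^{1/α}) − 2·H(u) ) = Δ^{α/2}H(u). -/
open MeasureTheory

/-- The long-range jump kernel `s y = c * |y| ^ (-(1+α))` (equal to `0` at `y = 0`). -/
noncomputable def sker (α c : ℝ) (y : ℝ) : ℝ := c * |y| ^ (-(1 + α))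

open Set Filter Topology

/-- The intervals on which `x ↦ ⌈x * N⌉₊` is constant. -/
lemma setOf_ceil_mul_eq {N : ℝ} (hN : 0 < N) (k : ℕ) :
    {x : ℝ | ⌈x * N⌉₊ = k + 1} = Ioc (k / N) ((k + 1) / N) := by
  ext x
  simp [Nat.ceil_eq_iff, div_lt_iff₀ hN, le_div_iff₀ hN]

lemma le_ceil_mul_div {N : ℝ} (hN : 0 < N) (x : ℝ) : x ≤ ⌈x * N⌉₊ / N :=
  (le_div_iff₀ hN).2 (Nat.le_ceil _)

lemma measurable_comp_ceil_mul_div (f : ℝ → ℝ) (N : ℝ) :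
    Measurable fun x : ℝ => f (⌈x * N⌉₊ / N) :=
  (measurable_from_nat (f := fun k : ℕ => f (k / N))).comp
    (Nat.measurable_ceil.comp (measurable_id.mul_const N))

lemma abs_comp_ceil_mul_div_le {f g : ℝ → ℝ} (hg : AntitoneOn g (Ioi 0))
    (hfg : ∀ x, 0 < x → |f x| ≤ g x) {N : ℝ} (hN : 0 < N) {x : ℝ} (hx : 0 < x) :
    |f (⌈x * N⌉₊ / N)| ≤ g x := by
  have h := le_ceil_mul_div hN x
  exact (hfg _ (hx.trans_le h)).trans (hg hx (hx.trans_le h) h)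

/-- A function dominated on `(0, ∞)` by an antitone integrable function has convergent Riemann
sums, which are integrals of step functions. -/
lemma hasSum_riemann {f g : ℝ → ℝ} (hg : AntitoneOn g (Ioi 0)) (hgi : IntegrableOn g (Ioi 0))
    (hfg : ∀ x, 0 < x → |f x| ≤ g x) {N : ℝ} (hN : 0 < N) :
    HasSum (fun k : ℕ => N⁻¹ * f ((k + 1) / N)) (∫ x in Ioi 0, f (⌈x * N⌉₊ / N)) := by
  have hU : (⋃ k : ℕ, {x : ℝ | ⌈x * N⌉₊ = k + 1}) = Ioi 0 := by
    ext x
    simp only [mem_iUnion, mem_ofPred_eq, mem_Ioi]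
    constructor
    · rintro ⟨k, hk⟩
      have : 0 < x * N := Nat.ceil_pos.1 (by omega)
      exact pos_of_mul_pos_left this hN.le
    · intro hx
      have := Nat.ceil_pos.2 (mul_pos hx hN)
      exact ⟨⌈x * N⌉₊ - 1, by omega⟩
  have hm : ∀ k : ℕ, MeasurableSet {x : ℝ | ⌈x * N⌉₊ = k + 1} := fun k => by
    rw [setOf_ceil_mul_eq hN]; exact measurableSet_Ioc
  have hd : Pairwise (Function.onFun Disjoint fun k : ℕ => {x : ℝ | ⌈x * N⌉₊ = k + 1}) := by
    intro i j hij
    refine Set.disjoint_left.2 fun x hi hj => hij ?_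
    simp only [mem_ofPred_eq] at hi hj
    omega
  have hi : IntegrableOn (fun x : ℝ => f (⌈x * N⌉₊ / N)) (Ioi 0) := by
    refine Integrable.mono' hgi (measurable_comp_ceil_mul_div f N).aestronglyMeasurable ?_
    filter_upwards [ae_restrict_mem measurableSet_Ioi] with x hx
    exact abs_comp_ceil_mul_div_le hg hfg hN hx
  rw [← hU] at hi ⊢
  have hk : ∀ k : ℕ, ∫ x in {x : ℝ | ⌈x * N⌉₊ = k + 1}, f (⌈x * N⌉₊ / N) =
      N⁻¹ * f ((k + 1) / N) := fun k => by
    rw [setIntegral_congr_fun (g := fun _ => f ((k + 1) / N)) (hm k), setIntegral_const,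
      setOf_ceil_mul_eq hN, Real.volume_real_Ioc_of_le (by gcongr; simp)]
    · rw [smul_eq_mul]; ring
    · intro x hx
      have hx' : ⌈x * N⌉₊ = k + 1 := hx
      simp [hx']
  simpa only [hk] using hasSum_integral_iUnion hm hd hi

/-- The Riemann sums of a continuous function on `(0, ∞)` dominated by an antitone integrable
function converge to its integral. -/
lemma tendsto_riemann {f g : ℝ → ℝ} (hf : ContinuousOn f (Ioi 0)) (hg : AntitoneOn g (Ioi 0))
    (hgi : IntegrableOn g (Ioi 0)) (hfg : ∀ x, 0 < x → |f x| ≤ g x) :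
    Tendsto (fun N : ℝ => N⁻¹ * ∑' k : ℕ, f ((k + 1) / N)) atTop (𝓝 (∫ x in Ioi 0, f x)) := by
  have h : Tendsto (fun N : ℝ => ∫ x in Ioi 0, f (⌈x * N⌉₊ / N)) atTop
      (𝓝 (∫ x in Ioi 0, f x)) := by
    refine tendsto_integral_filter_of_dominated_convergence g
      (Eventually.of_forall fun N => (measurable_comp_ceil_mul_div f N).aestronglyMeasurable)
      ?_ hgi ?_
    · filter_upwards [eventually_gt_atTop 0] with N hN
      filter_upwards [ae_restrict_mem measurableSet_Ioi] with x hx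
      exact abs_comp_ceil_mul_div_le hg hfg hN hx
    · filter_upwards [ae_restrict_mem measurableSet_Ioi] with x hx
      exact (hf.continuousAt (Ioi_mem_nhds hx)).tendsto.comp
        (tendsto_nat_ceil_mul_div_atTop (le_of_lt hx))
  refine h.congr' ?_
  filter_upwards [eventually_gt_atTop 0] with N hN
  rw [← (hasSum_riemann hg hgi hfg hN).tsum_eq, tsum_mul_left]

/-- An antitone integrable majorant on `(0, ∞)` of `y ^ (-(1 + α)) * min (y ^ 2) 1`. -/
noncomputable def jumpMajorant (α y : ℝ) : ℝ :=
  if y ≤ 1 then y ^ (-max (α - 1) 0) else y ^ (-(1 + α))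

lemma jumpMajorant_antitoneOn {α : ℝ} (hα : 0 < α) : AntitoneOn (jumpMajorant α) (Ioi 0) := by
  intro x hx y hy hxy
  have hx : 0 < x := hx
  have hb : -max (α - 1) 0 ≤ 0 := neg_nonpos.2 (le_max_right _ _)
  unfold jumpMajorant
  split_ifs with h1 h2 h2
  · exact Real.rpow_le_rpow_of_nonpos hx hxy hb
  · linarith
  · exact (Real.rpow_le_one_of_one_le_of_nonpos (not_le.1 h1).le (by linarith)).trans
      (Real.one_le_rpow_of_pos_of_le_one_of_nonpos hx h2 hb)
  · exact Real.rpow_le_rpow_of_nonpos hx hxy (by linarith)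

lemma jumpMajorant_integrableOn {α : ℝ} (hα0 : 0 < α) (hα2 : α < 2) :
    IntegrableOn (jumpMajorant α) (Ioi 0) := by
  rw [← Ioc_union_Ioi_eq_Ioi zero_le_one]
  refine IntegrableOn.union ?_ ?_
  · have : IntegrableOn (fun y : ℝ => y ^ (-max (α - 1) 0)) (Ioc 0 1) :=
      (intervalIntegral.intervalIntegrable_rpow' (neg_lt_neg
        (max_lt (by linarith) one_pos))).1
    exact this.congr_fun (fun y hy => by simp [jumpMajorant, hy.2]) measurableSet_Ioc
  · exact (integrableOn_Ioi_rpow_of_lt (a := -(1 + α)) (by linarith) one_pos).congr_fun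
      (fun y hy => by simp [jumpMajorant, not_le.2 (mem_Ioi.1 hy)]) measurableSet_Ioi

lemma rpow_mul_le_jumpMajorant {α K y d : ℝ} (hK : 0 ≤ K) (hy : 0 < y)
    (h1 : |d| ≤ K * y ^ 2) (h2 : |d| ≤ K) :
    y ^ (-(1 + α)) * |d| ≤ K * jumpMajorant α y := by
  have hp : 0 ≤ y ^ (-(1 + α)) := Real.rpow_nonneg hy.le _
  unfold jumpMajorant
  split_ifs with h
  · calc y ^ (-(1 + α)) * |d| ≤ y ^ (-(1 + α)) * (K * y ^ 2) := by gcongr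
      _ = K * y ^ (1 - α) := by
        rw [mul_left_comm, ← Real.rpow_natCast y 2, ← Real.rpow_add hy]
        congr 2; push_cast; ring
      _ ≤ K * y ^ (-max (α - 1) 0) := by
        gcongr K * ?_
        exact Real.rpow_le_rpow_of_exponent_ge hy h (by linarith [le_max_left (α - 1) 0])
  · rw [mul_comm K]; gcongr

lemma SchwartzMap.exists_abs_le (f : SchwartzMap ℝ ℝ) : ∃ C, 0 ≤ C ∧ ∀ x, |f x| ≤ C := by
  obtain ⟨C, hC, h⟩ := f.decay 0 0
  exact ⟨C, hC.le, fun x => by simpa using h x⟩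

/-- Symmetric second differences of a Schwartz function are bounded, and quadratically small. -/
lemma SchwartzMap.exists_second_difference_le (H : SchwartzMap ℝ ℝ) (u : ℝ) :
    ∃ K, 0 ≤ K ∧ ∀ y, 0 < y → |H (u + y) + H (u - y) - 2 * H u| ≤ K * y ^ 2 ∧
      |H (u + y) + H (u - y) - 2 * H u| ≤ K := by
  obtain ⟨A, hA, hHA⟩ := H.exists_abs_le
  set H₁ := SchwartzMap.derivCLM ℝ ℝ H with hH₁
  obtain ⟨B, hB, hHB⟩ := (SchwartzMap.derivCLM ℝ ℝ H₁).exists_abs_le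
  have hd : ∀ x, HasDerivAt H (H₁ x) x := fun x => by
    rw [hH₁, SchwartzMap.derivCLM_apply]; exact H.hasDerivAt x
  have hlip : ∀ x y, |H₁ y - H₁ x| ≤ B * |y - x| := fun x y =>
    Convex.norm_image_sub_le_of_norm_deriv_le (s := univ) (fun x _ => H₁.differentiableAt)
      (fun x _ => by rw [← SchwartzMap.derivCLM_apply ℝ]; exact hHB x) convex_univ
      (mem_univ x) (mem_univ y)
  refine ⟨4 * A + 2 * B, by positivity, fun y hy => ⟨?_, ?_⟩⟩
  · have hD : ∀ t, HasDerivAt (fun t => H (u + t) + H (u - t)) (H₁ (u + t) - H₁ (u - t)) t := by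
      intro t
      have h := ((hd (u + t)).comp_const_add u t).add ((hd (u - t)).comp_const_sub u t)
      exact h.congr_deriv (by ring)
    have h := Convex.norm_image_sub_le_of_norm_hasDerivWithin_le (s := Icc 0 y)
      (C := 2 * B * y) (fun t _ => (hD t).hasDerivWithinAt) (fun t ht => ?_) (convex_Icc 0 y)
      (left_mem_Icc.2 hy.le) (right_mem_Icc.2 hy.le)
    · have h' : |H (u + y) + H (u - y) - 2 * H u| ≤ 2 * B * y * y := by
        simpa [abs_of_pos hy, two_mul] using h
      nlinarith [mul_nonneg hA (sq_nonneg y)]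
    · refine (hlip _ _).trans ?_
      rw [show u + t - (u - t) = 2 * t by ring, abs_of_nonneg (by linarith [ht.1])]
      nlinarith [mul_le_mul_of_nonneg_left ht.2 hB]
  · have h1 := abs_le.1 (hHA (u + y))
    have h2 := abs_le.1 (hHA (u - y))
    have h3 := abs_le.1 (hHA u)
    exact abs_le.2 ⟨by linarith, by linarith⟩

/-- convergence of the rescaled discrete long-range generator to
the fractional Laplacian: for `0 < α < 2`, `c > 0`, Schwartz `H` and `u ∈ ℝ`,
`(1/(2 n^{1/α})) ∑_{y∈ℤ∖{0}} s(y/n^{1/α}) (H(u+y/n^{1/α}) + H(u−y/n^{1/α}) − 2H(u))`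
converges to `Δ^{α/2}H(u)` as `n → ∞`. -/
theorem discrete_generator_tendsto_fracLap
    (α c : ℝ) (hα0 : 0 < α) (hα2 : α < 2) (hc : 0 < c)
    (H : SchwartzMap ℝ ℝ) (u : ℝ) :
    Filter.Tendsto (fun n : ℕ =>
        (1 / (2 * (n : ℝ) ^ (1 / α))) *
          ∑' y : {y : ℤ // y ≠ 0},
            sker α c (((y : ℤ) : ℝ) / (n : ℝ) ^ (1 / α)) *
              (H (u + ((y : ℤ) : ℝ) / (n : ℝ) ^ (1 / α)) +
                H (u - ((y : ℤ) : ℝ) / (n : ℝ) ^ (1 / α)) - 2 * H u))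
      Filter.atTop (nhds (fracLap α c ⇑H u)) := by
  obtain ⟨K, hK, hD⟩ := H.exists_second_difference_le u
  set F : ℝ → ℝ := fun y => sker α c y * (H (u + y) + H (u - y) - 2 * H u) with hF
  have hF0 : F 0 = 0 := by simp [hF, ← two_mul]
  have hFneg : ∀ y, F (-y) = F y := fun y => by
    simp only [hF, sker, abs_neg, sub_neg_eq_add, ← sub_eq_add_neg]; ring
  have hcont : ContinuousOn F (Ioi 0) := by
    have hs : ContinuousOn (sker α c) (Ioi 0) := fun y hy =>
      (continuousAt_const.mul (continuous_abs.continuousAt.rpow_const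
        (Or.inl (abs_pos.2 (ne_of_gt (mem_Ioi.1 hy))).ne'))).continuousWithinAt
    have hH := H.continuous
    exact hs.mul (by fun_prop)
  have hg : AntitoneOn (fun y => c * (K * jumpMajorant α y)) (Ioi 0) := fun x hx y hy hxy => by
    have := jumpMajorant_antitoneOn hα0 hx hy hxy
    dsimp only
    gcongr
  have hgi : IntegrableOn (fun y => c * (K * jumpMajorant α y)) (Ioi 0) :=
    ((jumpMajorant_integrableOn hα0 hα2).const_mul K).const_mul c
  have hFg : ∀ y, 0 < y → |F y| ≤ c * (K * jumpMajorant α y) := fun y hy => by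
    have := rpow_mul_le_jumpMajorant (α := α) hK hy (hD y hy).1 (hD y hy).2
    simp only [hF, sker]
    rw [abs_mul, abs_mul, abs_of_pos hc, abs_of_pos hy,
      abs_of_nonneg (Real.rpow_nonneg hy.le _), mul_assoc]
    gcongr
  have hlim : fracLap α c H u = ∫ y in Ioi 0, F y := by
    have h : ∀ y : ℝ, c * |y| ^ (-(1 + α)) * (H (u + y) - 2 * H u + H (u - y)) = F |y| := by
      intro y
      have : F |y| = F y := by
        rcases abs_choice y with h | h <;> rw [h]
        exact hFneg y
      rw [this]; simp only [hF, sker]; ring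
    simp only [fracLap, h]
    rw [integral_comp_abs]; ring
  rw [hlim]
  have hN : Tendsto (fun n : ℕ => (n : ℝ) ^ (1 / α)) atTop atTop :=
    (tendsto_rpow_atTop (one_div_pos.2 hα0)).comp tendsto_natCast_atTop_atTop
  refine ((tendsto_riemann hcont hg hgi hFg).comp hN).congr' ?_
  filter_upwards [hN.eventually_gt_atTop 0] with n hn
  simp only [Function.comp_apply]
  generalize (n : ℝ) ^ (1 / α) = N at hn ⊢
  have hsupp : Function.support (fun y : ℤ => F (y / N)) ⊆ {y | y ≠ 0} := by
    intro y hy h0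
    exact hy (by simp [h0, hF0])
  have heven : Function.Even fun y : ℤ => F (y / N) := fun y => by
    simp [neg_div, hFneg]
  have hsum : Summable fun k : ℕ => F (k / N) := by
    have h := (summable_mul_left_iff (inv_ne_zero hn.ne')).1
      (hasSum_riemann hg hgi hFg hn).summable
    exact (summable_nat_add_iff 1).1 (by simpa using h)
  have hsumZ : Summable fun y : ℤ => F (y / N) :=
    Summable.of_nat_of_neg (by simpa using hsum) (by simpa [neg_div, hFneg] using hsum)
  have key := (tsum_subtype_eq_of_support_subset hsupp).trans
    (tsum_int_eq_zero_add_two_mul_tsum_pnat heven hsumZ)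
  have hp := tsum_pnat_eq_tsum_succ (f := fun k : ℕ => F (k / N))
  simp only [Int.cast_natCast, Int.cast_zero, zero_div, hF0, zero_add, hp, nsmul_eq_mul,
    Nat.cast_add, Nat.cast_one, Nat.cast_ofNat] at key
  refine Eq.trans ?_ (congrArg (fun t => 1 / (2 * N) * t) key.symm)
  field_simp
end

section
/- Let 0<α<2, c>0, s(y)=c·|y|^{-(1+α)} for y≠0, and let H:ℝ→ℝ be a Schwartz function. For n≥1 and x∈ℤ set D_nH(x) = (1/(2·n^{1/α}))·∑_{y∈ℤ∖{0}} s(y/n^{1/α})·Δ^n_{x,y}H. Then lim_{n→∞} (1/n^{1/α})·∑_{x∈ℤ} ( D_nH(x) − Δ^{α/2}H(x/n^{1/α}) )² = 0. -/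
open MeasureTheory

/-- The discrete second difference
`Δ^n_{x,y}H = H((x+y)/n^{1/α}) + H((x−y)/n^{1/α}) − 2·H(x/n^{1/α})`. -/
noncomputable def discLap (α : ℝ) (H : ℝ → ℝ) (n : ℕ) (x y : ℤ) : ℝ :=
  H (((x + y : ℤ) : ℝ) / (n : ℝ) ^ (1 / α)) +
    H (((x - y : ℤ) : ℝ) / (n : ℝ) ^ (1 / α)) -
    2 * H ((x : ℝ) / (n : ℝ) ^ (1 / α))

/-- The rescaled discrete long-range generator
`D_nH(x) = (1/(2 n^{1/α})) ∑_{y∈ℤ∖{0}} s(y/n^{1/α}) Δ^n_{x,y}H`. -/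
noncomputable def discGen (α c : ℝ) (H : ℝ → ℝ) (n : ℕ) (x : ℤ) : ℝ :=
  (1 / (2 * (n : ℝ) ^ (1 / α))) *
    ∑' y : {y : ℤ // y ≠ 0},
      sker α c (((y : ℤ) : ℝ) / (n : ℝ) ^ (1 / α)) * discLap α H n x y

open Filter Topology ENNReal

/-- The weight `t ↦ (1 + t²)⁻¹`. -/
noncomputable def cauchyWeight (t : ℝ) : ℝ := (1 + t ^ 2)⁻¹

lemma cauchyWeight_nonneg (t : ℝ) : 0 ≤ cauchyWeight t := by
  unfold cauchyWeight; positivity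

lemma cauchyWeight_le_one (t : ℝ) : cauchyWeight t ≤ 1 :=
  inv_le_one_of_one_le₀ (by nlinarith [sq_nonneg t])

lemma cauchyWeight_le_of_abs_sub_le_one {u t : ℝ} (h : |u - t| ≤ 1) :
    cauchyWeight u ≤ 3 * cauchyWeight t := by
  unfold cauchyWeight
  rw [← div_eq_mul_inv, inv_eq_one_div, div_le_div_iff₀ (by positivity) (by positivity)]
  have h1 : (u - t) ^ 2 ≤ 1 := (sq_le_one_iff_abs_le_one _).2 h
  nlinarith [sq_nonneg (t - 2 * u)]

lemma SchwartzMap.exists_abs_le_cauchyWeight (f : SchwartzMap ℝ ℝ) :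
    ∃ K, 0 ≤ K ∧ ∀ t, |f t| ≤ K * cauchyWeight t := by
  obtain ⟨C₀, h₀, h0⟩ := f.decay 0 0
  obtain ⟨C₂, h₂, h2⟩ := f.decay 2 0
  refine ⟨C₀ + C₂, by positivity, fun t => ?_⟩
  have a := h0 t
  have b := h2 t
  simp only [norm_iteratedFDeriv_zero, Real.norm_eq_abs, sq_abs, pow_zero, one_mul] at a b
  rw [cauchyWeight, ← div_eq_mul_inv, le_div_iff₀ (by positivity)]
  linarith

lemma SchwartzMap.exists_abs_sub_le_cauchyWeight (f : SchwartzMap ℝ ℝ) :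
    ∃ K, 0 ≤ K ∧ ∀ u v, |u - v| ≤ 1 → |f u - f v| ≤ K * |u - v| * cauchyWeight v := by
  obtain ⟨K, hK, h⟩ := (SchwartzMap.derivCLM ℝ ℝ f).exists_abs_le_cauchyWeight
  refine ⟨3 * K, by positivity, fun u v huv => ?_⟩
  have key := (convex_closedBall v 1).norm_image_sub_le_of_norm_deriv_le (f := f)
    (C := 3 * K * cauchyWeight v) (x := v) (y := u)
    (fun x _ => f.differentiable x) (fun x hx => ?_) (by simp)
    (by simpa [Real.dist_eq] using huv)
  · simp only [Real.norm_eq_abs] at key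
    linarith
  · have hx' : |x - v| ≤ 1 := by simpa [Real.dist_eq] using hx
    have h1 := h x
    rw [SchwartzMap.derivCLM_apply] at h1
    rw [Real.norm_eq_abs]
    nlinarith [cauchyWeight_le_of_abs_sub_le_one hx']

/-- The symmetric second difference `H (x + y) + H (x - y) - 2 H x`. -/
def secondDiff (H : ℝ → ℝ) (x y : ℝ) : ℝ := H (x + y) + H (x - y) - 2 * H x

lemma SchwartzMap.exists_abs_secondDiff_sub_le (f : SchwartzMap ℝ ℝ) :
    ∃ K, 0 ≤ K ∧ ∀ x y z, |y - z| ≤ 1 → |secondDiff f x y - secondDiff f x z| ≤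
      K * |y - z| * (cauchyWeight (z + x) + cauchyWeight (-z + x)) := by
  obtain ⟨K, hK, h⟩ := f.exists_abs_sub_le_cauchyWeight
  refine ⟨K, hK, fun x y z hyz => ?_⟩
  have e1 : x + y - (x + z) = y - z := by ring
  have e2 : x - y - (x - z) = -(y - z) := by ring
  have h1 := h (x + y) (x + z) (by rwa [e1])
  have h2 := h (x - y) (x - z) (by rwa [e2, abs_neg])
  rw [e1] at h1
  rw [e2, abs_neg] at h2
  rw [add_comm z x, neg_add_eq_sub]
  calc |secondDiff f x y - secondDiff f x z|
      = |(f (x + y) - f (x + z)) + (f (x - y) - f (x - z))| := by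
        simp only [secondDiff]; congr 1; ring
    _ ≤ _ := (abs_add_le _ _).trans (by linarith)

lemma SchwartzMap.exists_abs_secondDiff_le_of_abs_le_one (f : SchwartzMap ℝ ℝ) :
    ∃ K, 0 ≤ K ∧ ∀ x y, |y| ≤ 1 → |secondDiff f x y| ≤ K * y ^ 2 * cauchyWeight x := by
  obtain ⟨K, hK, h⟩ := (SchwartzMap.derivCLM ℝ ℝ f).exists_abs_sub_le_cauchyWeight
  refine ⟨2 * K, by positivity, fun x y hy => ?_⟩
  have hd : ∀ t, HasDerivAt (secondDiff f x) (deriv f (x + t) - deriv f (x - t)) t := by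
    intro t
    have h1 := (f.differentiable (x + t)).hasDerivAt.comp_const_add x t
    have h2 := (f.differentiable (x - t)).hasDerivAt.comp_const_sub x t
    exact ((h1.add h2).sub_const (2 * f x)).congr_deriv (by ring)
  have key := (convex_closedBall (0 : ℝ) |y|).norm_image_sub_le_of_norm_hasDerivWithin_le
    (f := secondDiff f x) (C := 2 * K * |y| * cauchyWeight x) (x := 0) (y := y)
    (fun t _ => (hd t).hasDerivWithinAt) (fun t ht => ?_) (by simp) (by simp)
  · have h0 : secondDiff f x 0 = 0 := by simp [secondDiff]; ring
    simp only [Real.norm_eq_abs, h0, sub_zero] at key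
    calc _ ≤ _ := key
      _ = _ := by rw [← sq_abs y]; ring
  · have ht' : |t| ≤ |y| := by simpa using ht
    have h1 := h (x + t) x (by simpa using ht'.trans hy)
    have h2 := h (x - t) x (by simpa using ht'.trans hy)
    simp only [SchwartzMap.derivCLM_apply, add_sub_cancel_left, sub_sub_cancel_left, abs_neg]
      at h1 h2
    have h3 : K * |t| * cauchyWeight x ≤ K * |y| * cauchyWeight x := by
      have := cauchyWeight_nonneg x
      gcongr
    calc ‖deriv f (x + t) - deriv f (x - t)‖
        = |(deriv f (x + t) - deriv f x) - (deriv f (x - t) - deriv f x)| := by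
          rw [Real.norm_eq_abs]; congr 1; ring
      _ ≤ _ := (abs_sub _ _).trans (by linarith)

lemma SchwartzMap.exists_abs_secondDiff_le (f : SchwartzMap ℝ ℝ) :
    ∃ K, 0 ≤ K ∧ ∀ x y, |secondDiff f x y| ≤ K * min 1 (y ^ 2) *
      (cauchyWeight (y + x) + cauchyWeight (-y + x) + cauchyWeight (0 + x)) := by
  obtain ⟨K₁, hK₁, h₁⟩ := f.exists_abs_secondDiff_le_of_abs_le_one
  obtain ⟨K₂, hK₂, h₂⟩ := f.exists_abs_le_cauchyWeight
  refine ⟨K₁ + 2 * K₂, by positivity, fun x y => ?_⟩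
  rw [add_comm y x, neg_add_eq_sub, zero_add]
  have q1 := cauchyWeight_nonneg (x + y)
  have q2 := cauchyWeight_nonneg (x - y)
  have q3 := cauchyWeight_nonneg x
  rcases le_total |y| 1 with hy | hy
  · have hy2 : y ^ 2 ≤ 1 := (sq_le_one_iff_abs_le_one _).2 hy
    rw [min_eq_right hy2]
    calc _ ≤ K₁ * y ^ 2 * cauchyWeight x := h₁ x y hy
      _ ≤ _ := by gcongr <;> linarith
  · have hy2 : 1 ≤ y ^ 2 := (one_le_sq_iff_one_le_abs _).2 hy
    rw [min_eq_left hy2, mul_one]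
    have a1 := abs_le.1 (h₂ (x + y))
    have a2 := abs_le.1 (h₂ (x - y))
    have a3 := abs_le.1 (h₂ x)
    have b1 := mul_nonneg hK₁ q1
    have b2 := mul_nonneg hK₁ q2
    have b3 := mul_nonneg hK₁ q3
    have c1 := mul_nonneg hK₂ q1
    have c2 := mul_nonneg hK₂ q2
    unfold secondDiff
    rw [abs_le]
    constructor <;> linarith

/-- The nearest point to `y` on the lattice `h ℤ`. -/
noncomputable def latticeRound (h y : ℝ) : ℝ := (round (y / h) : ℤ) * h

lemma measurable_round_div (h : ℝ) : Measurable fun y : ℝ => round (y / h) := by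
  simp only [round_eq]
  exact Int.measurable_floor.comp (by fun_prop)

lemma measurable_latticeRound (h : ℝ) : Measurable (latticeRound h) := by
  have : Measurable fun n : ℤ => (n : ℝ) := measurable_from_top
  exact (this.comp (measurable_round_div h)).mul_const h

lemma abs_latticeRound_sub_le {h : ℝ} (hh : 0 < h) (y : ℝ) : |latticeRound h y - y| ≤ h / 2 := by
  have e : latticeRound h y - y = -(y / h - round (y / h)) * h := by
    unfold latticeRound; field_simp; ring
  rw [e, abs_mul, abs_neg, abs_of_pos hh]
  nlinarith [abs_sub_round (y / h)]

lemma le_abs_latticeRound {h y : ℝ} (hh : 0 < h) (hy : latticeRound h y ≠ 0) :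
    h ≤ |latticeRound h y| := by
  have h0 : round (y / h) ≠ 0 := fun h0 => hy (by simp [latticeRound, h0])
  have h1 : (1 : ℝ) ≤ |((round (y / h) : ℤ) : ℝ)| := by exact_mod_cast Int.one_le_abs h0
  rw [latticeRound, abs_mul, abs_of_pos hh]
  nlinarith

lemma map_round_div_volume {h : ℝ} (hh : 0 < h) :
    Measure.map (fun y : ℝ => round (y / h)) volume = ENNReal.ofReal h • Measure.count := by
  refine Measure.ext_of_singleton fun k => ?_
  rw [Measure.map_apply (measurable_round_div h) (measurableSet_singleton k)]
  have : (fun y : ℝ => round (y / h)) ⁻¹' {k} = Set.Ico ((k - 1 / 2) * h) ((k + 1 / 2) * h) := by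
    ext y
    simp only [Set.mem_preimage, Set.mem_singleton_iff, round_eq_iff, Set.mem_Ico]
    rw [le_div_iff₀ hh, div_lt_iff₀ hh]
  rw [this, Real.volume_Ico]
  simp
  congr 1
  ring

lemma lintegral_comp_latticeRound {h : ℝ} (hh : 0 < h) (f : ℝ → ℝ≥0∞) :
    ∫⁻ y, f (latticeRound h y) = ENNReal.ofReal h * ∑' k : ℤ, f (k * h) := by
  have := lintegral_map (μ := volume) (f := fun k : ℤ => f (k * h)) measurable_from_top
    (measurable_round_div h)
  rw [map_round_div_volume hh, lintegral_smul_measure, lintegral_count] at this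
  exact this.symm

lemma integral_comp_latticeRound {h : ℝ} (hh : 0 < h) {f : ℝ → ℝ}
    (hf : Integrable fun y => f (latticeRound h y)) :
    ∫ y, f (latticeRound h y) = h * ∑' k : ℤ, f (k * h) := by
  have hm : AEStronglyMeasurable (fun k : ℤ => f (k * h))
      (Measure.map (fun y : ℝ => round (y / h)) volume) :=
    (measurable_from_top (α := ℤ)).aestronglyMeasurable
  have e := integral_map (measurable_round_div h).aemeasurable hm
  have hi := (integrable_map_measure hm (measurable_round_div h).aemeasurable).2 hf
  rw [integral_countable hi, map_round_div_volume hh] at e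
  rw [← tsum_mul_left]
  refine e.symm.trans (tsum_congr fun k => ?_)
  simp [Measure.real, hh.le]

lemma exists_tsum_cauchyWeight_le :
    ∃ C : ℝ, 0 ≤ C ∧ ∀ h a : ℝ, 0 < h → h ≤ 1 →
      ENNReal.ofReal h * ∑' k : ℤ, ENNReal.ofReal (cauchyWeight (a + k * h)) ≤
        ENNReal.ofReal C := by
  have hi : Integrable (fun y => 3 * cauchyWeight y) := integrable_inv_one_add_sq.const_mul 3
  refine ⟨∫ y, 3 * cauchyWeight y,
    integral_nonneg fun y => by have := cauchyWeight_nonneg y; positivity, fun h a hh h1 => ?_⟩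
  rw [← lintegral_comp_latticeRound hh fun x => ENNReal.ofReal (cauchyWeight (a + x)),
    ofReal_integral_eq_lintegral_ofReal hi
      (ae_of_all _ fun y => by have := cauchyWeight_nonneg y; positivity),
    ← lintegral_add_left_eq_self (fun y => ENNReal.ofReal (3 * cauchyWeight y)) a]
  refine lintegral_mono fun y => ENNReal.ofReal_le_ofReal ?_
  refine cauchyWeight_le_of_abs_sub_le_one ?_
  rw [add_sub_add_left_eq_sub]
  linarith [abs_latticeRound_sub_le hh y]

lemma ofReal_mul_tsum_enorm_le {h K C₀ : ℝ} {g : ℤ → ℝ} {a₁ a₂ a₃ : ℝ} (hK : 0 ≤ K)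
    (hC : ∀ a : ℝ, ENNReal.ofReal h * ∑' k : ℤ, ENNReal.ofReal (cauchyWeight (a + k * h)) ≤
      ENNReal.ofReal C₀) (hC₀ : 0 ≤ C₀)
    (hg : ∀ k : ℤ, |g k| ≤ K * (cauchyWeight (a₁ + k * h) + cauchyWeight (a₂ + k * h) +
      cauchyWeight (a₃ + k * h))) :
    ENNReal.ofReal h * ∑' k : ℤ, ‖g k‖ₑ ≤ ENNReal.ofReal (3 * C₀ * K) := by
  have hle : ∀ k : ℤ, ‖g k‖ₑ ≤ ENNReal.ofReal K * (ENNReal.ofReal (cauchyWeight (a₁ + k * h)) +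
      ENNReal.ofReal (cauchyWeight (a₂ + k * h)) +
      ENNReal.ofReal (cauchyWeight (a₃ + k * h))) := by
    intro k
    have q1 := cauchyWeight_nonneg (a₁ + k * h)
    have q2 := cauchyWeight_nonneg (a₂ + k * h)
    have q3 := cauchyWeight_nonneg (a₃ + k * h)
    rw [← ENNReal.ofReal_add q1 q2, ← ENNReal.ofReal_add (by positivity) q3,
      ← ENNReal.ofReal_mul hK, ← ofReal_norm]
    exact ENNReal.ofReal_le_ofReal (hg k)
  calc ENNReal.ofReal h * ∑' k : ℤ, ‖g k‖ₑ
      ≤ ENNReal.ofReal h * ∑' k : ℤ, ENNReal.ofReal K *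
          (ENNReal.ofReal (cauchyWeight (a₁ + k * h)) +
            ENNReal.ofReal (cauchyWeight (a₂ + k * h)) +
            ENNReal.ofReal (cauchyWeight (a₃ + k * h))) := by
        gcongr with k; exact hle k
    _ = ENNReal.ofReal K *
          (ENNReal.ofReal h * ∑' k : ℤ, ENNReal.ofReal (cauchyWeight (a₁ + k * h)) +
            ENNReal.ofReal h * ∑' k : ℤ, ENNReal.ofReal (cauchyWeight (a₂ + k * h)) +
            ENNReal.ofReal h * ∑' k : ℤ, ENNReal.ofReal (cauchyWeight (a₃ + k * h))) := by
        rw [ENNReal.tsum_mul_left, ENNReal.tsum_add, ENNReal.tsum_add]; ring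
    _ ≤ ENNReal.ofReal K * (ENNReal.ofReal C₀ + ENNReal.ofReal C₀ + ENNReal.ofReal C₀) := by
        gcongr <;> exact hC _
    _ = ENNReal.ofReal (3 * C₀ * K) := by
        rw [← ENNReal.ofReal_add hC₀ hC₀, ← ENNReal.ofReal_add (by positivity) hC₀,
          ← ENNReal.ofReal_mul hK]
        congr 1; ring

lemma SchwartzMap.exists_tsum_enorm_secondDiff_le (f : SchwartzMap ℝ ℝ) :
    ∃ K, 0 ≤ K ∧ ∀ h y, 0 < h → h ≤ 1 →
      ENNReal.ofReal h * ∑' k : ℤ, ‖secondDiff f (k * h) y‖ₑ ≤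
        ENNReal.ofReal (K * min 1 (y ^ 2)) := by
  obtain ⟨C, hC, hC'⟩ := exists_tsum_cauchyWeight_le
  obtain ⟨K, hK, hK'⟩ := f.exists_abs_secondDiff_le
  refine ⟨3 * C * K, by positivity, fun h y hh h1 => ?_⟩
  rw [mul_assoc]
  exact ofReal_mul_tsum_enorm_le (by positivity) (fun a => hC' h a hh h1) hC
    fun k => hK' (k * h) y

lemma SchwartzMap.exists_tsum_enorm_secondDiff_sub_le (f : SchwartzMap ℝ ℝ) :
    ∃ K, 0 ≤ K ∧ ∀ h y z, 0 < h → h ≤ 1 → |y - z| ≤ 1 →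
      ENNReal.ofReal h * ∑' k : ℤ, ‖secondDiff f (k * h) y - secondDiff f (k * h) z‖ₑ ≤
        ENNReal.ofReal (K * |y - z|) := by
  obtain ⟨C, hC, hC'⟩ := exists_tsum_cauchyWeight_le
  obtain ⟨K, hK, hK'⟩ := f.exists_abs_secondDiff_sub_le
  refine ⟨3 * C * K, by positivity, fun h y z hh h1 hyz => ?_⟩
  rw [mul_assoc]
  refine ofReal_mul_tsum_enorm_le (by positivity) (fun a => hC' h a hh h1) hC
    (a₁ := z) (a₂ := -z) (a₃ := 0) fun k => (hK' (k * h) y z hyz).trans ?_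
  exact mul_le_mul_of_nonneg_left (le_add_of_nonneg_right (cauchyWeight_nonneg _)) (by positivity)

lemma ofReal_mul_tsum_enorm_add_le (h a b : ℝ) (u v : ℤ → ℝ) :
    ENNReal.ofReal h * ∑' k, ‖a * u k + b * v k‖ₑ ≤
      ‖a‖ₑ * (ENNReal.ofReal h * ∑' k, ‖u k‖ₑ) + ‖b‖ₑ * (ENNReal.ofReal h * ∑' k, ‖v k‖ₑ) := by
  calc _ ≤ ENNReal.ofReal h * ∑' k, (‖a‖ₑ * ‖u k‖ₑ + ‖b‖ₑ * ‖v k‖ₑ) := by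
        gcongr with k
        exact (enorm_add_le _ _).trans (by simp [enorm_mul])
    _ = _ := by
        rw [ENNReal.tsum_add, ENNReal.tsum_mul_left, ENNReal.tsum_mul_left]; ring

lemma sker_nonneg {α c : ℝ} (hc : 0 ≤ c) (y : ℝ) : 0 ≤ sker α c y := by
  unfold sker; positivity

lemma sker_zero {α : ℝ} (hα : 0 < α) (c : ℝ) : sker α c 0 = 0 := by
  rw [sker, abs_zero, Real.zero_rpow (by linarith), mul_zero]

lemma measurable_sker (α c : ℝ) : Measurable (sker α c) := by
  unfold sker; fun_prop

lemma continuousAt_sker (α c : ℝ) {y : ℝ} (hy : y ≠ 0) : ContinuousAt (sker α c) y := by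
  unfold sker
  exact continuousAt_const.mul (continuous_abs.continuousAt.rpow_const (Or.inl (abs_ne_zero.2 hy)))

lemma integrable_sker_mul_min {α : ℝ} (c : ℝ) (hα0 : 0 < α) (hα2 : α < 2) :
    Integrable fun y => sker α c y * min 1 (y ^ 2) := by
  have hm : Measurable fun y => sker α c y * min 1 (y ^ 2) :=
    (measurable_sker α c).mul (by fun_prop)
  have hpos : IntegrableOn (fun y => sker α c y * min 1 (y ^ 2)) (Set.Ioi 0) := by
    rw [← Set.Ioc_union_Ioi_eq_Ioi zero_le_one]
    refine IntegrableOn.union ?_ ?_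
    · have h1 : IntegrableOn (fun y : ℝ => c * y ^ (1 - α)) (Set.Ioc 0 1) :=
        ((intervalIntegrable_iff_integrableOn_Ioc_of_le zero_le_one).1
          (intervalIntegral.intervalIntegrable_rpow' (by linarith))).const_mul c
      refine h1.congr_fun (fun y hy => ?_) measurableSet_Ioc
      have : y ^ 2 ≤ 1 := pow_le_one₀ hy.1.le hy.2
      simp only [sker, abs_of_pos hy.1, min_eq_right this]
      rw [← Real.rpow_natCast y 2, mul_assoc, ← Real.rpow_add hy.1]
      congr 2; push_cast; ring
    · have h1 : IntegrableOn (fun y : ℝ => c * y ^ (-(1 + α))) (Set.Ioi 1) :=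
        (integrableOn_Ioi_rpow_of_lt (by linarith) zero_lt_one).const_mul c
      refine h1.congr_fun (fun y hy => ?_) measurableSet_Ioi
      have hy : 1 < y := hy
      have : 1 ≤ y ^ 2 := one_le_pow₀ hy.le
      simp only [sker, abs_of_pos (zero_lt_one.trans hy), min_eq_left this, mul_one]
  have hneg : IntegrableOn (fun y => sker α c y * min 1 (y ^ 2)) (Set.Iio 0) := by
    have := ((Measure.measurePreserving_neg (volume : Measure ℝ)).integrableOn_comp_preimage
      (Homeomorph.neg ℝ).measurableEmbedding (s := Set.Ioi 0)).2 hpos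
    refine (this.congr_fun (fun y _ => ?_) (by measurability)).mono_set (fun y hy => ?_)
    · simp [sker]
    · simpa using hy
  rw [← integrableOn_univ, ← Set.Iic_union_Ioi (a := (0 : ℝ))]
  exact ((integrableOn_Iic_iff_integrableOn_Iio (by finiteness)).2 hneg).union hpos

lemma sker_latticeRound_mul_min_le {α c h : ℝ} (hα : 0 < α) (hc : 0 ≤ c) (hh : 0 < h) (y : ℝ) :
    sker α c (latticeRound h y) * min 1 (latticeRound h y ^ 2) ≤
      4 * 2 ^ (1 + α) * (sker α c y * min 1 (y ^ 2)) := by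
  have hs := sker_nonneg (α := α) hc y
  by_cases hr : latticeRound h y = 0
  · rw [hr, sker_zero hα, zero_mul]
    positivity
  have h1 := le_abs_latticeRound hh hr
  have h2 := abs_latticeRound_sub_le hh y
  generalize latticeRound h y = r at *
  have h3 : |r| ≤ |r - y| + |y| := by simpa using abs_add_le (r - y) y
  have h4 : |y| ≤ |r - y| + |r| := by
    rw [abs_sub_comm r y]; simpa using abs_add_le (y - r) r
  have hr0 : 0 < |r| := abs_pos.2 hr
  have hy0 : 0 < |y| := by linarith
  have e1 : |r| ^ (-(1 + α)) ≤ 2 ^ (1 + α) * |y| ^ (-(1 + α)) := by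
    calc |r| ^ (-(1 + α)) ≤ (|y| / 2) ^ (-(1 + α)) :=
          Real.rpow_le_rpow_of_nonpos (by positivity) (by linarith) (by linarith)
      _ = _ := by
          rw [Real.div_rpow hy0.le zero_le_two, Real.rpow_neg zero_le_two, div_inv_eq_mul, mul_comm]
  have e2 : min 1 (r ^ 2) ≤ 4 * min 1 (y ^ 2) := by
    have : r ^ 2 ≤ 4 * y ^ 2 := by
      rw [← sq_abs r, ← sq_abs y]; nlinarith
    rcases min_cases 1 (y ^ 2) with ⟨e, -⟩ | ⟨e, -⟩ <;> rw [e]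
    · linarith [min_le_left 1 (r ^ 2)]
    · exact (min_le_right _ _).trans this
  calc sker α c r * min 1 (r ^ 2)
      ≤ (c * (2 ^ (1 + α) * |y| ^ (-(1 + α)))) * (4 * min 1 (y ^ 2)) := by
        unfold sker; gcongr
    _ = _ := by unfold sker; ring

lemma continuous_secondDiff {H : ℝ → ℝ} (hH : Continuous H) (x : ℝ) :
    Continuous (secondDiff H x) := by
  unfold secondDiff; fun_prop

lemma measurable_sker_mul_secondDiff (α c : ℝ) {H : ℝ → ℝ} (hH : Continuous H) (x : ℝ) :
    Measurable fun y => sker α c y * secondDiff H x y :=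
  (measurable_sker α c).mul (continuous_secondDiff hH x).measurable

lemma tendsto_latticeRound (y : ℝ) :
    Tendsto (fun h => latticeRound h y) (𝓝[>] 0) (𝓝 y) := by
  rw [tendsto_iff_dist_tendsto_zero]
  have h0 : Tendsto (fun h : ℝ => h / 2) (𝓝[>] 0) (𝓝 0) := by
    have : Tendsto (fun h : ℝ => h / 2) (𝓝 0) (𝓝 (0 / 2)) := tendsto_id.div_const 2
    rw [zero_div] at this
    exact this.mono_left nhdsWithin_le_nhds
  refine squeeze_zero' (Eventually.of_forall fun _ => dist_nonneg) ?_ h0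
  filter_upwards [self_mem_nhdsWithin] with h hh
  exact abs_latticeRound_sub_le hh y

lemma SchwartzMap.exists_tsum_enorm_kernel_sub_le {α c : ℝ} (hα : 0 < α) (hc : 0 ≤ c)
    (f : SchwartzMap ℝ ℝ) :
    ∃ K, 0 ≤ K ∧ ∀ h y, 0 < h → h ≤ 1 →
      ENNReal.ofReal h * ∑' k : ℤ, ‖sker α c (latticeRound h y) *
        secondDiff f (k * h) (latticeRound h y) - sker α c y * secondDiff f (k * h) y‖ₑ ≤
        ENNReal.ofReal (K * (sker α c y * min 1 (y ^ 2))) := by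
  obtain ⟨K, hK, hK'⟩ := f.exists_tsum_enorm_secondDiff_le
  refine ⟨K * (4 * 2 ^ (1 + α) + 1), by positivity, fun h y hh h1 => ?_⟩
  have hs := sker_nonneg (α := α) hc y
  have hr := sker_nonneg (α := α) hc (latticeRound h y)
  have key := ofReal_mul_tsum_enorm_add_le h (sker α c (latticeRound h y)) (-sker α c y)
    (fun k => secondDiff f (k * h) (latticeRound h y)) (fun k => secondDiff f (k * h) y)
  simp only [neg_mul, ← sub_eq_add_neg] at key
  refine key.trans ?_
  rw [enorm_neg, Real.enorm_of_nonneg hs, Real.enorm_of_nonneg hr]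
  calc _ ≤ ENNReal.ofReal (sker α c (latticeRound h y)) *
          ENNReal.ofReal (K * min 1 (latticeRound h y ^ 2)) +
        ENNReal.ofReal (sker α c y) * ENNReal.ofReal (K * min 1 (y ^ 2)) := by
        gcongr
        · exact hK' _ _ hh h1
        · exact hK' _ _ hh h1
    _ ≤ _ := by
        rw [← ENNReal.ofReal_mul hs, ← ENNReal.ofReal_mul hr,
          ← ENNReal.ofReal_add (by positivity) (by positivity)]
        refine ENNReal.ofReal_le_ofReal ?_
        have := mul_le_mul_of_nonneg_left (sker_latticeRound_mul_min_le hα hc hh y) hK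
        nlinarith

lemma SchwartzMap.tendsto_tsum_enorm_kernel_sub {α c : ℝ} (hc : 0 ≤ c)
    (f : SchwartzMap ℝ ℝ) {y : ℝ} (hy : y ≠ 0) :
    Tendsto (fun h => ENNReal.ofReal h * ∑' k : ℤ, ‖sker α c (latticeRound h y) *
        secondDiff f (k * h) (latticeRound h y) - sker α c y * secondDiff f (k * h) y‖ₑ)
      (𝓝[>] 0) (𝓝 0) := by
  obtain ⟨K₁, hK₁, h₁⟩ := f.exists_tsum_enorm_secondDiff_le
  obtain ⟨K₂, hK₂, h₂⟩ := f.exists_tsum_enorm_secondDiff_sub_le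
  have hs := sker_nonneg (α := α) hc y
  have hlim : Tendsto (fun h => ENNReal.ofReal
      (|sker α c (latticeRound h y) - sker α c y| * K₁ +
        sker α c y * (K₂ * |latticeRound h y - y|))) (𝓝[>] 0) (𝓝 0) := by
    have hr := tendsto_latticeRound y
    have e1 := ((((continuousAt_sker α c hy).tendsto.comp hr).sub_const (sker α c y)).abs.mul_const
      K₁).add (((hr.sub_const y).abs.const_mul K₂).const_mul (sker α c y))
    have e2 := ENNReal.tendsto_ofReal e1
    simpa using e2
  refine tendsto_of_tendsto_of_tendsto_of_le_of_le' tendsto_const_nhds hlim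
    (Eventually.of_forall fun _ => zero_le) ?_
  filter_upwards [Ioc_mem_nhdsGT zero_lt_one] with h hh
  have hle := abs_latticeRound_sub_le hh.1 y
  generalize latticeRound h y = r at *
  have key := ofReal_mul_tsum_enorm_add_le h (sker α c r - sker α c y) (sker α c y)
    (fun k => secondDiff f (k * h) r) (fun k => secondDiff f (k * h) r - secondDiff f (k * h) y)
  have e : ∀ k : ℤ, (sker α c r - sker α c y) * secondDiff f (k * h) r +
      sker α c y * (secondDiff f (k * h) r - secondDiff f (k * h) y) =
      sker α c r * secondDiff f (k * h) r - sker α c y * secondDiff f (k * h) y := fun k => by ring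
  simp only [e] at key
  refine key.trans ?_
  rw [Real.enorm_of_nonneg hs, ← ofReal_norm, Real.norm_eq_abs,
    ENNReal.ofReal_add (by positivity) (by positivity), ENNReal.ofReal_mul (abs_nonneg _),
    ENNReal.ofReal_mul hs]
  gcongr
  · refine (h₁ h r hh.1 hh.2).trans (ENNReal.ofReal_le_ofReal ?_)
    exact mul_le_of_le_one_right hK₁ (min_le_left _ _)
  · exact h₂ h r y hh.1 hh.2 (by linarith [hh.2])

/-- Half the difference between the lattice and the continuum integrals of the kernel against the
second difference of `H` at `x`. -/
noncomputable def discretizationError (α c : ℝ) (H : ℝ → ℝ) (h x : ℝ) : ℝ :=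
  (1 / 2) * ∫ y, (sker α c (latticeRound h y) * secondDiff H x (latticeRound h y) -
    sker α c y * secondDiff H x y)

lemma SchwartzMap.tendsto_tsum_enorm_discretizationError {α c : ℝ} (hα0 : 0 < α) (hα2 : α < 2)
    (hc : 0 ≤ c) (f : SchwartzMap ℝ ℝ) :
    Tendsto (fun h => ENNReal.ofReal h * ∑' k : ℤ, ‖discretizationError α c f h (k * h)‖ₑ)
      (𝓝[>] 0) (𝓝 0) := by
  obtain ⟨K, hK, hK'⟩ := f.exists_tsum_enorm_kernel_sub_le hα0 hc
  have hmeas : ∀ h x, Measurable fun y => sker α c (latticeRound h y) *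
      secondDiff f x (latticeRound h y) - sker α c y * secondDiff f x y := fun h x =>
    ((measurable_sker_mul_secondDiff α c f.continuous x).comp (measurable_latticeRound h)).sub
      (measurable_sker_mul_secondDiff α c f.continuous x)
  have hlim := tendsto_lintegral_filter_of_dominated_convergence (μ := volume) (l := 𝓝[>] (0 : ℝ))
    (F := fun h y => ENNReal.ofReal h * ∑' k : ℤ, ‖sker α c (latticeRound h y) *
        secondDiff f (k * h) (latticeRound h y) - sker α c y * secondDiff f (k * h) y‖ₑ)
    (f := fun _ => 0)
    (fun y => ENNReal.ofReal (K * (sker α c y * min 1 (y ^ 2))))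
    (Eventually.of_forall fun h => Measurable.const_mul
      (Measurable.tsum fun k => (hmeas h _).enorm) _)
    (by
      filter_upwards [Ioc_mem_nhdsGT zero_lt_one] with h hh
      exact ae_of_all _ fun y => hK' h y hh.1 hh.2)
    (((integrable_sker_mul_min c hα0 hα2).const_mul K).lintegral_lt_top.ne)
    (by
      filter_upwards [compl_mem_ae_iff.2 (measure_singleton (0 : ℝ))] with y hy
      exact f.tendsto_tsum_enorm_kernel_sub hc hy)
  rw [lintegral_zero] at hlim
  refine tendsto_of_tendsto_of_tendsto_of_le_of_le tendsto_const_nhds hlim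
    (fun _ => zero_le) fun h => ?_
  simp only
  rw [lintegral_const_mul _ (Measurable.tsum fun k => (hmeas h _).enorm),
    lintegral_tsum fun k => (hmeas h _).enorm.aemeasurable]
  gcongr with k
  rw [discretizationError, enorm_mul]
  refine (mul_le_mul' ?_ (enorm_integral_le_lintegral_enorm _)).trans (one_mul _).le
  rw [Real.enorm_of_nonneg (by norm_num), ENNReal.ofReal_le_one]
  norm_num

lemma SchwartzMap.exists_abs_sker_mul_secondDiff_le (α : ℝ) {c : ℝ} (hc : 0 ≤ c)
    (f : SchwartzMap ℝ ℝ) :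
    ∃ K, 0 ≤ K ∧ ∀ x y, ‖sker α c y * secondDiff f x y‖ ≤
      K * (sker α c y * min 1 (y ^ 2)) := by
  obtain ⟨K, hK, h⟩ := f.exists_abs_secondDiff_le
  refine ⟨3 * K, by positivity, fun x y => ?_⟩
  have hs := sker_nonneg (α := α) hc y
  rw [Real.norm_eq_abs, abs_mul, abs_of_nonneg hs]
  calc _ ≤ sker α c y * (K * min 1 (y ^ 2) * (1 + 1 + 1)) := by
        refine mul_le_mul_of_nonneg_left ((h x y).trans ?_) hs
        gcongr <;> exact cauchyWeight_le_one _
    _ = _ := by ring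

lemma SchwartzMap.integrable_sker_mul_secondDiff {α c : ℝ} (hα0 : 0 < α) (hα2 : α < 2)
    (hc : 0 ≤ c) (f : SchwartzMap ℝ ℝ) (x : ℝ) :
    Integrable fun y => sker α c y * secondDiff f x y := by
  obtain ⟨K, -, h⟩ := f.exists_abs_sker_mul_secondDiff_le α hc
  exact ((integrable_sker_mul_min c hα0 hα2).const_mul K).mono'
    (measurable_sker_mul_secondDiff α c f.continuous x).aestronglyMeasurable (ae_of_all _ (h x))

lemma SchwartzMap.integrable_sker_mul_secondDiff_latticeRound {α c h : ℝ} (hα0 : 0 < α)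
    (hα2 : α < 2) (hc : 0 ≤ c) (f : SchwartzMap ℝ ℝ) (hh : 0 < h) (x : ℝ) :
    Integrable fun y => sker α c (latticeRound h y) * secondDiff f x (latticeRound h y) := by
  obtain ⟨K, hK, hK'⟩ := f.exists_abs_sker_mul_secondDiff_le α hc
  refine (((integrable_sker_mul_min c hα0 hα2).const_mul (4 * 2 ^ (1 + α))).const_mul K).mono'
    ((measurable_sker_mul_secondDiff α c f.continuous x).comp
      (measurable_latticeRound h)).aestronglyMeasurable (ae_of_all _ fun y => ?_)
  exact (hK' x _).trans
    (mul_le_mul_of_nonneg_left (sker_latticeRound_mul_min_le hα0 hc hh y) hK)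

lemma SchwartzMap.exists_abs_discretizationError_le {α c : ℝ} (hα0 : 0 < α) (hα2 : α < 2)
    (hc : 0 ≤ c) (f : SchwartzMap ℝ ℝ) :
    ∃ M, 0 ≤ M ∧ ∀ h x, 0 < h → |discretizationError α c f h x| ≤ M := by
  obtain ⟨K, hK, hK'⟩ := f.exists_abs_sker_mul_secondDiff_le α hc
  have hi := (integrable_sker_mul_min c hα0 hα2).const_mul (K * (4 * 2 ^ (1 + α) + 1))
  have hb : ∀ h x, 0 < h → |discretizationError α c f h x| ≤
      1 / 2 * ∫ y, K * (4 * 2 ^ (1 + α) + 1) * (sker α c y * min 1 (y ^ 2)) := by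
    intro h x hh
    rw [discretizationError, abs_mul, abs_of_nonneg (by norm_num : (0 : ℝ) ≤ 1 / 2)]
    refine mul_le_mul_of_nonneg_left ?_ (by norm_num)
    rw [← Real.norm_eq_abs]
    refine norm_integral_le_of_norm_le hi (ae_of_all _ fun y => ?_)
    refine (norm_sub_le _ _).trans ((add_le_add ((hK' x _).trans (mul_le_mul_of_nonneg_left
      (sker_latticeRound_mul_min_le hα0 hc hh y) hK)) (hK' x y)).trans (le_of_eq (by ring)))
  exact ⟨_, (abs_nonneg _).trans (hb 1 0 one_pos), hb⟩

lemma ofReal_mul_tsum_sq_le {h M : ℝ} (hh : 0 ≤ h) {g : ℤ → ℝ} (hg : ∀ k, |g k| ≤ M) :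
    ENNReal.ofReal (h * ∑' k, g k ^ 2) ≤
      ENNReal.ofReal M * (ENNReal.ofReal h * ∑' k, ‖g k‖ₑ) := by
  by_cases hs : Summable fun k => g k ^ 2
  · rw [ENNReal.ofReal_mul hh, ENNReal.ofReal_tsum_of_nonneg (fun k => sq_nonneg _) hs,
      mul_left_comm, ← ENNReal.tsum_mul_left (a := ENNReal.ofReal M)]
    gcongr with k
    rw [← ofReal_norm, ← ENNReal.ofReal_mul ((abs_nonneg _).trans (hg k)),
      Real.norm_eq_abs, ← sq_abs, sq]
    exact ENNReal.ofReal_le_ofReal (mul_le_mul_of_nonneg_right (hg k) (abs_nonneg _))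
  · simp [tsum_eq_zero_of_not_summable hs]

lemma SchwartzMap.tendsto_tsum_sq_discretizationError {α c : ℝ} (hα0 : 0 < α) (hα2 : α < 2)
    (hc : 0 ≤ c) (f : SchwartzMap ℝ ℝ) :
    Tendsto (fun h => h * ∑' k : ℤ, discretizationError α c f h (k * h) ^ 2) (𝓝[>] 0) (𝓝 0) := by
  obtain ⟨M, -, hM⟩ := f.exists_abs_discretizationError_le hα0 hα2 hc
  have h1 := ENNReal.Tendsto.const_mul (a := ENNReal.ofReal M)
    (f.tendsto_tsum_enorm_discretizationError hα0 hα2 hc) (Or.inr ENNReal.ofReal_ne_top)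
  rw [mul_zero] at h1
  have h2 : Tendsto (fun h => ENNReal.ofReal
      (h * ∑' k : ℤ, discretizationError α c f h (k * h) ^ 2)) (𝓝[>] 0) (𝓝 0) := by
    refine tendsto_of_tendsto_of_tendsto_of_le_of_le' tendsto_const_nhds h1
      (Eventually.of_forall fun _ => zero_le) ?_
    filter_upwards [self_mem_nhdsWithin] with h hh
    exact ofReal_mul_tsum_sq_le (le_of_lt hh) fun k => hM h _ hh
  have h3 := (ENNReal.tendsto_toReal ENNReal.zero_ne_top).comp h2
  rw [ENNReal.toReal_zero] at h3
  refine h3.congr' ?_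
  filter_upwards [self_mem_nhdsWithin] with h hh
  have hh' : 0 < h := hh
  exact ENNReal.toReal_ofReal (mul_nonneg hh'.le (tsum_nonneg fun k => sq_nonneg _))

lemma fracLap_eq (α c : ℝ) (H : ℝ → ℝ) (x : ℝ) :
    fracLap α c H x = 1 / 2 * ∫ y, sker α c y * secondDiff H x y := by
  unfold fracLap sker secondDiff
  congr 3
  ext y
  ring

lemma SchwartzMap.discGen_sub_fracLap {α c : ℝ} (hα0 : 0 < α) (hα2 : α < 2) (hc : 0 ≤ c)
    (H : SchwartzMap ℝ ℝ) {n : ℕ} (hn : 0 < n) (x : ℤ) :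
    discGen α c H n x - fracLap α c H (x / (n : ℝ) ^ (1 / α)) =
      discretizationError α c H ((n : ℝ) ^ (1 / α))⁻¹ (x * ((n : ℝ) ^ (1 / α))⁻¹) := by
  have hN : 0 < (n : ℝ) ^ (1 / α) := by positivity
  have hgen : discGen α c H n x = 1 / 2 * ∫ y, sker α c (latticeRound ((n : ℝ) ^ (1 / α))⁻¹ y) *
      secondDiff H (x * ((n : ℝ) ^ (1 / α))⁻¹) (latticeRound ((n : ℝ) ^ (1 / α))⁻¹ y) := by
    rw [integral_comp_latticeRound (inv_pos.2 hN)
      (f := fun y => sker α c y * secondDiff H (x * ((n : ℝ) ^ (1 / α))⁻¹) y)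
      (H.integrable_sker_mul_secondDiff_latticeRound hα0 hα2 hc (inv_pos.2 hN) _)]
    have hsum : ∑' y : {y : ℤ // y ≠ 0},
        sker α c (((y : ℤ) : ℝ) / (n : ℝ) ^ (1 / α)) * discLap α H n x y =
        ∑' k : ℤ, sker α c (k * ((n : ℝ) ^ (1 / α))⁻¹) *
          secondDiff H (x * ((n : ℝ) ^ (1 / α))⁻¹) (k * ((n : ℝ) ^ (1 / α))⁻¹) := by
      refine (tsum_subtype_eq_of_support_subset (s := {y : ℤ | y ≠ 0})
        (f := fun y : ℤ => sker α c ((y : ℝ) / (n : ℝ) ^ (1 / α)) * discLap α H n x y)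
        fun y hy h0 => hy ?_).trans (tsum_congr fun k => ?_)
      · simp [h0, sker_zero hα0]
      · simp only [discLap, secondDiff, div_eq_mul_inv, Int.cast_add, Int.cast_sub, add_mul,
          sub_mul]
    rw [discGen, hsum, ← mul_assoc, ← one_div_mul_one_div, one_div ((n : ℝ) ^ (1 / α))]
  rw [hgen, discretizationError, integral_sub
    (H.integrable_sker_mul_secondDiff_latticeRound hα0 hα2 hc (inv_pos.2 hN) _)
    (H.integrable_sker_mul_secondDiff hα0 hα2 hc _), mul_sub, fracLap_eq,
    div_eq_mul_inv (x : ℝ)]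

/-- summed L²-convergence of the discrete generator to the
fractional Laplacian:
`(1/n^{1/α}) ∑_{x∈ℤ} (D_nH(x) − Δ^{α/2}H(x/n^{1/α}))² → 0` as `n → ∞`. -/
theorem discrete_generator_L2_convergence
    (α c : ℝ) (hα0 : 0 < α) (hα2 : α < 2) (hc : 0 < c)
    (H : SchwartzMap ℝ ℝ) :
    Filter.Tendsto (fun n : ℕ =>
        (1 / (n : ℝ) ^ (1 / α)) *
          ∑' x : ℤ,
            (discGen α c (⇑H) n x -
              fracLap α c (⇑H) ((x : ℝ) / (n : ℝ) ^ (1 / α))) ^ 2)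
      Filter.atTop (nhds 0) := by
  have hh : Filter.Tendsto (fun n : ℕ => ((n : ℝ) ^ (1 / α))⁻¹) Filter.atTop (𝓝[>] 0) := by
    refine tendsto_inv_atTop_nhdsGT_zero.comp ?_
    exact (tendsto_rpow_atTop (by positivity)).comp tendsto_natCast_atTop_atTop
  refine ((H.tendsto_tsum_sq_discretizationError hα0 hα2 hc.le).comp hh).congr' ?_
  filter_upwards [Filter.eventually_gt_atTop 0] with n hn
  simp only [Function.comp_apply, H.discGen_sub_fracLap hα0 hα2 hc.le hn]
  rw [one_div ((n : ℝ) ^ (1 / α))]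
end

section
/- Let 0<α<2, c>0, s(y)=c·|y|^{-(1+α)} for y≠0, and let H:ℝ→ℝ be a Schwartz function. Then there is a constant C = C(H,α,c) > 0 such that for every integer n≥1, (1/n^{1/α})·∑_{x∈ℤ} ( (1/n^{1/α})·∑_{y∈ℤ∖{0}} s(y/n^{1/α})·Δ^n_{x,y}H )² ≤ C. -/
open MeasureTheory

/-- A Schwartz function on `ℝ` decays at least like `1 / (1 + x ^ 2)`. -/
lemma SchwartzMap.exists_abs_le_inv_one_add_sq (f : SchwartzMap ℝ ℝ) :
    ∃ K : ℝ, 0 ≤ K ∧ ∀ x, |f x| ≤ K * (1 + x ^ 2)⁻¹ := by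
  obtain ⟨C₀, h₀⟩ := f.decay 0 0
  obtain ⟨C₂, h₂⟩ := f.decay 2 0
  simp only [norm_iteratedFDeriv_zero, Real.norm_eq_abs, sq_abs, pow_zero, one_mul] at h₀ h₂
  refine ⟨C₀ + C₂, ?_, fun x => ?_⟩
  · have h1 := (abs_nonneg _).trans (h₀.2 0)
    have h2 := h₂.2 0
    simp at h2
    linarith
  · rw [← div_eq_mul_inv, le_div_iff₀ (by positivity)]
    linarith [h₀.2 x, h₂.2 x]

lemma inv_one_add_sq_le_three_mul {u z : ℝ} (h : |z - u| ≤ 1) :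
    (1 + z ^ 2)⁻¹ ≤ 3 * (1 + u ^ 2)⁻¹ := by
  rw [← div_eq_mul_inv, le_div_iff₀ (by positivity), inv_mul_le_iff₀ (by positivity)]
  have := abs_le.1 h
  nlinarith [sq_nonneg (2 * z - u)]

/-- The second difference of a function whose second derivative is at most `M` within distance `|v|`
of `u`. -/
lemma abs_second_difference_le_s9 {H H₁ H₂ : ℝ → ℝ} (hH : ∀ x, HasDerivAt H (H₁ x) x)
    (hH₁ : ∀ x, HasDerivAt H₁ (H₂ x) x) {u v M : ℝ}
    (hM : ∀ z, |z - u| ≤ |v| → |H₂ z| ≤ M) :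
    |H (u + v) + H (u - v) - 2 * H u| ≤ 2 * M * v ^ 2 := by
  have first : ∀ t ∈ Metric.closedBall (0 : ℝ) |v|, ‖H₁ (u + t) - H₁ (u - t)‖ ≤ 2 * M * |v| := by
    intro t ht
    rw [mem_closedBall_zero_iff, Real.norm_eq_abs] at ht
    have := (convex_closedBall u |v|).norm_image_sub_le_of_norm_hasDerivWithin_le
      (f := H₁) (f' := H₂) (x := u - t) (y := u + t) (C := M)
      (fun x _ => (hH₁ x).hasDerivWithinAt)
      (fun x hx => hM x (by simpa [Real.dist_eq] using hx))
      (by simpa [Real.dist_eq] using ht) (by simpa [Real.dist_eq] using ht)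
    have hM0 : 0 ≤ M := (abs_nonneg _).trans (hM u (by simp))
    calc _ ≤ M * ‖u + t - (u - t)‖ := this
      _ = 2 * M * |t| := by
        rw [show u + t - (u - t) = 2 * t by ring, Real.norm_eq_abs, abs_mul]; norm_num; ring
      _ ≤ _ := by gcongr
  have := (convex_closedBall (0 : ℝ) |v|).norm_image_sub_le_of_norm_hasDerivWithin_le
      (f := fun t => H (u + t) + H (u - t)) (f' := fun t => H₁ (u + t) - H₁ (u - t))
      (x := 0) (y := v) (C := 2 * M * |v|)
      (fun x _ => by
        have h1 := (hH (u + x)).comp_const_add u x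
        have h2 := (hH (u - x)).comp_const_sub u x
        rw [sub_eq_add_neg]
        exact (h1.add h2).hasDerivWithinAt)
      first (by simp) (by simp)
  simp only [add_zero, sub_zero, Real.norm_eq_abs] at this
  rw [mul_assoc, abs_mul_abs_self] at this
  convert this using 2 <;> ring

/-- The second difference of a Schwartz function, controlled simultaneously for small and large
increments. -/
lemma SchwartzMap.exists_abs_second_difference_le (H : SchwartzMap ℝ ℝ) :
    ∃ K : ℝ, 0 ≤ K ∧ ∀ u v : ℝ, |H (u + v) + H (u - v) - 2 * H u| ≤
      K * min 1 (v ^ 2) *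
        ((1 + (u + v) ^ 2)⁻¹ + (1 + (u - v) ^ 2)⁻¹ + 2 * (1 + u ^ 2)⁻¹) := by
  obtain ⟨K₀, hK₀, h₀⟩ := H.exists_abs_le_inv_one_add_sq
  obtain ⟨K₂, hK₂, h₂⟩ :=
    (derivCLM ℝ ℝ (derivCLM ℝ ℝ H)).exists_abs_le_inv_one_add_sq
  refine ⟨K₀ + 3 * K₂, by positivity, fun u v => ?_⟩
  have p1 : 0 ≤ (1 + (u + v) ^ 2)⁻¹ := by positivity
  have p2 : 0 ≤ (1 + (u - v) ^ 2)⁻¹ := by positivity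
  have p3 : 0 ≤ (1 + u ^ 2)⁻¹ := by positivity
  rcases le_or_gt |v| 1 with hv | hv
  · rw [min_eq_right ((sq_le_one_iff_abs_le_one v).2 hv)]
    have hd : ∀ (f : SchwartzMap ℝ ℝ) (x : ℝ), HasDerivAt f (derivCLM ℝ ℝ f x) x :=
      fun f x => by simpa using f.differentiableAt.hasDerivAt
    have := abs_second_difference_le_s9 (hd H) (hd (derivCLM ℝ ℝ H)) (u := u) (v := v)
      (M := K₂ * (3 * (1 + u ^ 2)⁻¹))
      (fun z hz => (h₂ z).trans (by gcongr; exact inv_one_add_sq_le_three_mul (hz.trans hv)))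
    refine this.trans ?_
    have : 0 ≤ v ^ 2 := sq_nonneg v
    calc 2 * (K₂ * (3 * (1 + u ^ 2)⁻¹)) * v ^ 2 = 3 * K₂ * v ^ 2 * (2 * (1 + u ^ 2)⁻¹) := by ring
      _ ≤ _ := by gcongr <;> linarith
  · rw [min_eq_left ((one_lt_sq_iff_one_lt_abs v).2 hv).le, mul_one]
    calc |H (u + v) + H (u - v) - 2 * H u| ≤ |H (u + v)| + |H (u - v)| + 2 * |H u| := by
          refine (abs_sub _ _).trans ?_
          rw [abs_mul, abs_two]
          gcongr
          exact abs_add_le _ _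
      _ ≤ K₀ * (1 + (u + v) ^ 2)⁻¹ + K₀ * (1 + (u - v) ^ 2)⁻¹ + 2 * (K₀ * (1 + u ^ 2)⁻¹) := by
          gcongr <;> apply h₀
      _ = K₀ * ((1 + (u + v) ^ 2)⁻¹ + (1 + (u - v) ^ 2)⁻¹ + 2 * (1 + u ^ 2)⁻¹) := by ring
      _ ≤ _ := by gcongr; linarith

/-- Right Riemann sums of a nonnegative antitone function are bounded by its integral. -/
lemma AntitoneOn.mul_sum_range_le_setIntegral_Ioi {f : ℝ → ℝ} (hf : AntitoneOn f (Set.Ioi 0))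
    (hf0 : ∀ x, 0 < x → 0 ≤ f x) (hint : IntegrableOn f (Set.Ioi 0)) {h : ℝ} (hh : 0 < h)
    (N : ℕ) :
    ∑ k ∈ Finset.range N, h * f (h * ((k : ℝ) + 1)) ≤ ∫ x in Set.Ioi 0, f x := by
  have hii : ∀ a b : ℝ, 0 ≤ a → a ≤ b → IntervalIntegrable f volume a b := fun a b ha hab =>
    (intervalIntegrable_iff_integrableOn_Ioc_of_le hab).2
      (hint.mono_set fun x hx => ha.trans_lt hx.1)
  have step : ∀ k : ℕ, h * (k : ℝ) ≤ h * ((k + 1 : ℕ) : ℝ) := fun k => by gcongr; simp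
  have hterm : ∀ k ∈ Finset.range N, h * f (h * ((k : ℝ) + 1)) ≤
      ∫ x in (h * (k : ℝ))..(h * ((k + 1 : ℕ) : ℝ)), f x := by
    intro k _
    have h0 : 0 ≤ h * (k : ℝ) := by positivity
    have hc : h * f (h * ((k : ℝ) + 1)) =
        ∫ _ in (h * (k : ℝ))..(h * ((k + 1 : ℕ) : ℝ)), f (h * ((k : ℝ) + 1)) := by
      rw [intervalIntegral.integral_const, smul_eq_mul]; push_cast; ring
    rw [hc]
    refine intervalIntegral.integral_mono_on_of_le_Ioo (step k) (by simp)
      (hii _ _ h0 (step k)) fun x hx => ?_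
    refine hf (h0.trans_lt hx.1) (by simp only [Set.mem_Ioi]; positivity) ?_
    simpa using hx.2.le
  refine (Finset.sum_le_sum hterm).trans ?_
  rw [intervalIntegral.sum_integral_adjacent_intervals (a := fun k : ℕ => h * (k : ℝ))
    fun k _ => hii _ _ (by positivity) (step k),
    intervalIntegral.integral_of_le (by simp; positivity)]
  refine setIntegral_mono_set hint ?_ (LE.le.eventuallyLE fun x hx => ?_)
  · exact (ae_restrict_iff' measurableSet_Ioi).2 (.of_forall hf0)
  · have := hx.1
    simpa using this

/-- Finite sums of an even nonnegative function on `ℤ` are controlled by those over `ℕ`. -/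
lemma sum_int_le_of_even {φ : ℤ → ℝ} (heven : ∀ k, φ (-k) = φ k) (h0 : ∀ k, 0 ≤ φ k) {I : ℝ}
    (hI : ∀ N : ℕ, ∑ k ∈ Finset.range N, φ ((k : ℤ) + 1) ≤ I) (X : Finset ℤ) :
    ∑ k ∈ X, φ k ≤ φ 0 + 2 * I := by
  obtain ⟨N, hN⟩ : ∃ N : ℕ, X ⊆ Finset.Icc (-N : ℤ) N := by
    refine ⟨X.sup Int.natAbs, fun k hk => ?_⟩
    have := Finset.le_sup (f := Int.natAbs) hk
    rw [Finset.mem_Icc]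
    omega
  refine (Finset.sum_le_sum_of_subset_of_nonneg hN fun k _ _ => h0 k).trans ?_
  rw [Finset.sum_Icc_of_even_eq_range (fun k => heven k), Finset.sum_range_succ']
  have := hI N
  push_cast
  simp only [nsmul_eq_mul]
  push_cast
  linarith

/-- Two-sided Riemann sums of `x ↦ f |x|`, excluding the origin. -/
lemma AntitoneOn.sum_int_le {f : ℝ → ℝ} (hf : AntitoneOn f (Set.Ioi 0))
    (hf0 : ∀ x, 0 < x → 0 ≤ f x) (hint : IntegrableOn f (Set.Ioi 0)) {h : ℝ} (hh : 0 < h)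
    {φ : ℤ → ℝ} (hφ : ∀ k, k ≠ 0 → φ k = h * f (h * |(k : ℝ)|)) (hφ0 : 0 ≤ φ 0) (X : Finset ℤ) :
    ∑ k ∈ X, φ k ≤ φ 0 + 2 * ∫ x in Set.Ioi 0, f x := by
  refine sum_int_le_of_even (fun k => ?_) (fun k => ?_) (fun N => ?_) X
  · rcases eq_or_ne k 0 with rfl | hk
    · simp
    · rw [hφ k hk, hφ (-k) (neg_ne_zero.2 hk)]; simp
  · rcases eq_or_ne k 0 with rfl | hk
    · exact hφ0
    · rw [hφ k hk]
      have : 0 < |(k : ℝ)| := abs_pos.2 (by exact_mod_cast hk)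
      exact mul_nonneg hh.le (hf0 _ (by positivity))
  · refine le_trans (le_of_eq ?_) (hf.mul_sum_range_le_setIntegral_Ioi hf0 hint hh N)
    refine Finset.sum_congr rfl fun k _ => ?_
    rw [hφ _ (by omega)]
    push_cast
    rw [abs_of_nonneg (by positivity)]

lemma exists_sum_int_inv_one_add_sq_le :
    ∃ G : ℝ, 0 ≤ G ∧ ∀ h : ℝ, 0 < h → h ≤ 1 → ∀ X : Finset ℤ,
      h * ∑ k ∈ X, (1 + (h * (k : ℝ)) ^ 2)⁻¹ ≤ G := by
  have hint : IntegrableOn (fun x : ℝ => (1 + x ^ 2)⁻¹) (Set.Ioi 0) :=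
    integrable_inv_one_add_sq.integrableOn
  have hnn : 0 ≤ ∫ x in Set.Ioi (0 : ℝ), (1 + x ^ 2)⁻¹ :=
    integral_nonneg fun x => by positivity
  refine ⟨1 + 2 * ∫ x in Set.Ioi (0 : ℝ), (1 + x ^ 2)⁻¹, by positivity, fun h hh hh1 X => ?_⟩
  have hanti : AntitoneOn (fun x : ℝ => (1 + x ^ 2)⁻¹) (Set.Ioi 0) := by
    intro a ha b _ hab
    have : 0 < a := ha
    simp only
    gcongr
  rw [Finset.mul_sum]
  refine (hanti.sum_int_le (fun x _ => by positivity) hint hh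
    (φ := fun k : ℤ => h * (1 + (h * (k : ℝ)) ^ 2)⁻¹) (fun k _ => ?_) (by positivity) X).trans ?_
  · simp only [mul_pow, sq_abs]
  · simpa using hh1

/-- The Lévy-type integrability of the kernel `|v| ^ (-(1 + α))` against `min 1 (v ^ 2)`, in
discretized form. -/
lemma exists_sum_int_sker_mul_min_le {α c : ℝ} (hα0 : 0 < α) (hα2 : α < 2) (hc : 0 < c) :
    ∃ B : ℝ, 0 ≤ B ∧ ∀ h : ℝ, 0 < h → ∀ Y : Finset ℤ,
      ∑ k ∈ Y, h * sker α c (h * (k : ℝ)) * min 1 ((h * (k : ℝ)) ^ 2) ≤ B := by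
  set γ : ℝ := max 0 (α - 1) with hγ
  have hγ0 : 0 ≤ γ := le_max_left _ _
  have hγ1 : γ < 1 := max_lt one_pos (by linarith)
  set f : ℝ → ℝ := fun x => if x ≤ 1 then c * x ^ (-γ) else c * x ^ (-(1 + α)) with hf
  have hf0 : ∀ x, 0 < x → 0 ≤ f x := fun x hx => by
    simp only [hf]; split_ifs <;> positivity
  have hanti : AntitoneOn f (Set.Ioi 0) := by
    intro a ha b hb hab
    have ha : 0 < a := ha
    have hb : 0 < b := hb
    simp only [hf]
    split_ifs with h1 h2 h2
    · exact mul_le_mul_of_nonneg_left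
        (Real.rpow_le_rpow_of_nonpos ha hab (by linarith)) hc.le
    · linarith
    · refine mul_le_mul_of_nonneg_left ?_ hc.le
      exact (Real.rpow_le_one_of_one_le_of_nonpos (by linarith) (by linarith)).trans
        (Real.one_le_rpow_of_pos_of_le_one_of_nonpos ha h2 (by linarith))
    · exact mul_le_mul_of_nonneg_left
        (Real.rpow_le_rpow_of_nonpos ha hab (by linarith)) hc.le
  have hint : IntegrableOn f (Set.Ioi 0) := by
    rw [← Set.Ioc_union_Ioi_eq_Ioi (zero_le_one' ℝ)]
    refine IntegrableOn.union ?_ ?_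
    · have : IntegrableOn (fun x : ℝ => c * x ^ (-γ)) (Set.Ioc 0 1) :=
        ((intervalIntegrable_iff_integrableOn_Ioc_of_le zero_le_one).1
          (intervalIntegral.intervalIntegrable_rpow' (by linarith))).const_mul c
      exact this.congr_fun (fun x hx => by simp [hf, hx.2]) measurableSet_Ioc
    · have : IntegrableOn (fun x : ℝ => c * x ^ (-(1 + α))) (Set.Ioi 1) :=
        (integrableOn_Ioi_rpow_of_lt (by linarith) one_pos).const_mul c
      exact this.congr_fun (fun x hx => by simp [hf, not_le.2 (Set.mem_Ioi.1 hx)])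
        measurableSet_Ioi
  have hnn : 0 ≤ ∫ x in Set.Ioi (0 : ℝ), f x := setIntegral_nonneg measurableSet_Ioi hf0
  refine ⟨2 * ∫ x in Set.Ioi (0 : ℝ), f x, by positivity, fun h hh Y => ?_⟩
  have key := hanti.sum_int_le hf0 hint hh
    (φ := fun k : ℤ => if k = 0 then 0 else h * f (h * |(k : ℝ)|))
    (fun k hk => by simp [hk]) (by simp) Y
  simp only [if_true, zero_add] at key
  refine le_trans (Finset.sum_le_sum fun k _ => ?_) key
  split_ifs with hk
  · simp [hk]
  · have hk' : 0 < |(k : ℝ)| := abs_pos.2 (by exact_mod_cast hk)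
    have hv : 0 < h * |(k : ℝ)| := by positivity
    have hsq : (h * (k : ℝ)) ^ 2 = (h * |(k : ℝ)|) ^ 2 := by simp only [mul_pow, sq_abs]
    rw [mul_assoc, sker, hsq, abs_mul, abs_of_pos hh]
    refine mul_le_mul_of_nonneg_left ?_ hh.le
    set v := h * |(k : ℝ)|
    simp only [hf]
    rw [mul_assoc]
    split_ifs with h1
    · refine mul_le_mul_of_nonneg_left ?_ hc.le
      calc v ^ (-(1 + α)) * min 1 (v ^ 2) ≤ v ^ (-(1 + α)) * v ^ 2 := by
            gcongr; exact min_le_right _ _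
        _ = v ^ (1 - α) := by
            rw [← Real.rpow_natCast v 2, ← Real.rpow_add hv]; congr 1; push_cast; ring
        _ ≤ v ^ (-γ) := Real.rpow_le_rpow_of_exponent_ge hv h1 (by
            linarith [le_max_right 0 (α - 1)])
    · refine mul_le_mul_of_nonneg_left ?_ hc.le
      exact mul_le_of_le_one_right (by positivity) (min_le_left _ _)

/-- Schur-type estimate: a bounded row mass and a bounded column mass give an `ℓ²` bound. -/
lemma mul_tsum_sq_tsum_le {w m g : ℤ → ℝ} {D : ℤ → ℤ → ℝ} {h K G B : ℝ}
    (hh : 0 ≤ h) (hK : 0 ≤ K) (hB : 0 ≤ B) (hw : ∀ y, 0 ≤ w y) (hm : ∀ y, 0 ≤ m y)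
    (hg1 : ∀ x, g x ≤ 1)
    (hD : ∀ x y, |D x y| ≤ K * m y * (g (x + y) + g (x - y) + 2 * g x))
    (hG : ∀ X : Finset ℤ, h * ∑ x ∈ X, g x ≤ G)
    (hwm : ∀ Y : Finset ℤ, ∑ y ∈ Y, w y * m y ≤ B) :
    h * ∑' x, (∑' y, w y * D x y) ^ 2 ≤ (4 * K * B) * (4 * K * G * B) := by
  have hG0 : 0 ≤ G := by simpa using hG ∅
  have hwm0 : ∀ y, 0 ≤ w y * m y := fun y => mul_nonneg (hw y) (hm y)
  have hsum : Summable fun y => w y * m y := summable_of_sum_le hwm0 hwm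
  have htsum : ∑' y, w y * m y ≤ B := hsum.tsum_le_of_sum_le hwm
  have hrow : ∀ x y, w y * |D x y| ≤ 4 * K * (w y * m y) := fun x y => by
    have h1 : |D x y| ≤ K * m y * 4 := (hD x y).trans (by
      have := hm y
      gcongr
      linarith [hg1 (x + y), hg1 (x - y), hg1 x])
    calc w y * |D x y| ≤ w y * (K * m y * 4) := mul_le_mul_of_nonneg_left h1 (hw y)
      _ = _ := by ring
  have habs : ∀ x, Summable fun y => w y * |D x y| := fun x =>
    Summable.of_nonneg_of_le (fun y => mul_nonneg (hw y) (abs_nonneg _)) (hrow x)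
      (hsum.mul_left _)
  have hle : ∀ x, |∑' y, w y * D x y| ≤ ∑' y, w y * |D x y| := fun x => by
    have e : ∀ y, ‖w y * D x y‖ = w y * |D x y| := fun y => by
      rw [Real.norm_eq_abs, abs_mul, abs_of_nonneg (hw y)]
    have := norm_tsum_le_tsum_norm (f := fun y => w y * D x y) (by simpa only [e] using habs x)
    simpa only [e, Real.norm_eq_abs] using this
  have hsup : ∀ x, |∑' y, w y * D x y| ≤ 4 * K * B := fun x =>
    calc _ ≤ ∑' y, w y * |D x y| := hle x
      _ ≤ ∑' y, 4 * K * (w y * m y) := (habs x).tsum_le_tsum (hrow x) (hsum.mul_left _)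
      _ ≤ 4 * K * B := by rw [tsum_mul_left]; gcongr
  have hcol : ∀ (X : Finset ℤ) (y : ℤ), h * ∑ x ∈ X, |D x y| ≤ 4 * K * G * m y := by
    intro X y
    have s1 : h * ∑ x ∈ X, g (x + y) ≤ G := by
      simpa using hG (X.map (Equiv.addRight y).toEmbedding)
    have s2 : h * ∑ x ∈ X, g (x - y) ≤ G := by
      simpa using hG (X.map (Equiv.subRight y).toEmbedding)
    calc h * ∑ x ∈ X, |D x y|
        ≤ h * ∑ x ∈ X, K * m y * (g (x + y) + g (x - y) + 2 * g x) := by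
          gcongr; exact hD _ _
      _ = K * m y * (h * ∑ x ∈ X, g (x + y) + h * ∑ x ∈ X, g (x - y) +
            2 * (h * ∑ x ∈ X, g x)) := by
          rw [← Finset.mul_sum, Finset.sum_add_distrib, Finset.sum_add_distrib,
            ← Finset.mul_sum]
          ring
      _ ≤ K * m y * (G + G + 2 * G) := by
          have := hm y
          gcongr
          exact hG X
      _ = _ := by ring
  have hl1 : ∀ X : Finset ℤ, h * ∑ x ∈ X, |∑' y, w y * D x y| ≤ 4 * K * G * B := fun X =>
    calc h * ∑ x ∈ X, |∑' y, w y * D x y| ≤ h * ∑ x ∈ X, ∑' y, w y * |D x y| := by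
          gcongr; exact hle _
      _ = ∑' y, h * ∑ x ∈ X, w y * |D x y| := by
          rw [tsum_mul_left, Summable.tsum_finsetSum fun x _ => habs x]
      _ ≤ ∑' y, 4 * K * G * (w y * m y) := by
          refine ((summable_sum fun x _ => habs x).mul_left h).tsum_le_tsum (fun y => ?_)
            (hsum.mul_left _)
          rw [← Finset.mul_sum]
          linarith [mul_le_mul_of_nonneg_left (hcol X y) (hw y)]
      _ ≤ 4 * K * G * B := by rw [tsum_mul_left]; gcongr
  rw [← tsum_mul_left]
  refine Real.tsum_le_of_sum_le (fun x => by positivity) fun X => ?_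
  calc ∑ x ∈ X, h * (∑' y, w y * D x y) ^ 2
      ≤ ∑ x ∈ X, 4 * K * B * (h * |∑' y, w y * D x y|) := by
        refine Finset.sum_le_sum fun x _ => ?_
        rw [← sq_abs, sq]
        have := mul_le_mul_of_nonneg_right (hsup x)
          (mul_nonneg hh (abs_nonneg (∑' y, w y * D x y)))
        linarith
    _ = 4 * K * B * (h * ∑ x ∈ X, |∑' y, w y * D x y|) := by
        rw [← Finset.mul_sum, ← Finset.mul_sum]
    _ ≤ _ := mul_le_mul_of_nonneg_left (hl1 X) (by positivity)

/-- uniform-in-`n` bound for the summed squares of the discrete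
generator: there is `C = C(H, α, c) > 0` with
`(1/n^{1/α}) ∑_{x∈ℤ} ((1/n^{1/α}) ∑_{y≠0} s(y/n^{1/α}) Δ^n_{x,y}H)² ≤ C`
for all `n ≥ 1`. -/
theorem discrete_generator_square_sum_bound
    (α c : ℝ) (hα0 : 0 < α) (hα2 : α < 2) (hc : 0 < c)
    (H : SchwartzMap ℝ ℝ) :
    ∃ C : ℝ, 0 < C ∧ ∀ n : ℕ, 1 ≤ n →
      (1 / (n : ℝ) ^ (1 / α)) *
        (∑' x : ℤ,
          ((1 / (n : ℝ) ^ (1 / α)) *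
            ∑' y : {y : ℤ // y ≠ 0},
              sker α c (((y : ℤ) : ℝ) / (n : ℝ) ^ (1 / α)) * discLap α (⇑H) n x y) ^ 2)
        ≤ C := by
  obtain ⟨K, hK, hH⟩ := H.exists_abs_second_difference_le
  obtain ⟨G, hG, hGsum⟩ := exists_sum_int_inv_one_add_sq_le
  obtain ⟨B, hB, hBsum⟩ := exists_sum_int_sker_mul_min_le hα0 hα2 hc
  refine ⟨(4 * K * B) * (4 * K * G * B) + 1, by positivity, fun n hn => ?_⟩
  have hN : 1 ≤ (n : ℝ) ^ (1 / α) := Real.one_le_rpow (by exact_mod_cast hn) (by positivity)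
  set N : ℝ := (n : ℝ) ^ (1 / α) with hN'
  set h : ℝ := 1 / N with hh'
  have hh : 0 < h := by positivity
  have hh1 : h ≤ 1 := by rw [hh', div_le_one (by positivity)]; exact hN
  have hdiv : ∀ t : ℝ, t / N = h * t := fun t => by rw [hh']; ring
  have hinner : ∀ x : ℤ, h * ∑' y : {y : ℤ // y ≠ 0},
      sker α c (((y : ℤ) : ℝ) / N) * discLap α H n x y =
      ∑' y : ℤ, h * sker α c (h * (y : ℝ)) * discLap α H n x y := fun x => by
    have hsupp : Function.support (fun y : ℤ => sker α c (h * (y : ℝ)) * discLap α H n x y) ⊆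
        {y : ℤ | y ≠ 0} := by
      intro y hy hy0
      refine hy ?_
      replace hy0 : y = 0 := hy0
      have : -(1 + α) ≠ 0 := by linarith
      simp only [hy0, sker, Int.cast_zero, mul_zero, abs_zero, Real.zero_rpow this, zero_mul]
    simp only [hdiv]
    simp only [mul_assoc h]
    rw [tsum_mul_left]
    exact congrArg (h * ·) (tsum_subtype_eq_of_support_subset hsupp)
  simp only [hinner]
  refine (mul_tsum_sq_tsum_le (w := fun y : ℤ => h * sker α c (h * (y : ℝ)))
    (m := fun y : ℤ => min 1 ((h * (y : ℝ)) ^ 2)) (g := fun x : ℤ => (1 + (h * (x : ℝ)) ^ 2)⁻¹)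
    (D := discLap α H n) hh.le hK hB (fun y => ?_) (fun y => ?_) (fun x => ?_)
    (fun x y => ?_) (hGsum h hh hh1) (hBsum h hh)).trans (by linarith)
  · simp only [sker]; positivity
  · positivity
  · exact inv_le_one_of_one_le₀ (by nlinarith [sq_nonneg (h * (x : ℝ))])
  · have := hH (h * x) (h * y)
    rw [← mul_add, ← mul_sub] at this
    simp only [discLap, ← hN', hdiv]
    push_cast
    exact this
end

section
/- Let 0<α<2, c>0, s(y)=c·|y|^{-(1+α)} for y≠0, and let H:ℝ→ℝ be a Schwartz function. Then lim_{n→∞} (1/n^{2/α})·∑_{x∈ℤ} ∑_{y∈ℤ∖{0}} s(y/n^{1/α})·( H((x+y)/n^{1/α}) − H(x/n^{1/α}) )² = ∫_ℝ∫_ℝ s(y)·(H(x+y) − H(x))² dy dx. -/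
open MeasureTheory

open Filter Topology

namespace FractionalDirichlet

theorem map_floor_volume :
    (volume : Measure ℝ).map (Int.floor : ℝ → ℤ) = Measure.count := by
  refine Measure.ext_iff_singleton.2 fun k => ?_
  rw [Measure.map_apply Int.measurable_floor (measurableSet_singleton k),
    Int.preimage_floor_singleton, Real.volume_Ico, Measure.count_singleton]
  simp

theorem integral_count_eq_tsum {ι : Type*} [Countable ι] [MeasurableSpace ι]
    [MeasurableSingletonClass ι] (f : ι → ℝ) :
    ∫ k, f k ∂Measure.count = ∑' k, f k := by
  by_cases hf : Integrable f Measure.count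
  · simp [integral_countable hf, Measure.real]
  · rw [integral_undef hf, tsum_eq_zero_of_not_summable]
    rwa [integrable_count_iff, summable_norm_iff] at hf

/-- The integral of a step function with steps of length `N⁻¹`; no summability is needed since both
sides vanish in its absence. -/
theorem integral_comp_floor_mul (f : ℤ → ℝ) {N : ℝ} (hN : 0 < N) :
    ∫ x : ℝ, f ⌊N * x⌋ = N⁻¹ * ∑' k, f k := by
  rw [Measure.integral_comp_mul_left (fun x : ℝ => f ⌊x⌋) N, abs_of_pos (inv_pos.2 hN),
    ← integral_count_eq_tsum, ← map_floor_volume,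
    integral_map Int.measurable_floor.aemeasurable (by fun_prop), smul_eq_mul]

theorem abs_floor_mul_div_sub_le {N : ℝ} (hN : 0 < N) (x : ℝ) :
    |(⌊N * x⌋ : ℝ) / N - x| ≤ 1 / N := by
  have h1 := Int.floor_le (N * x)
  have h2 := Int.lt_floor_add_one (N * x)
  have : (⌊N * x⌋ : ℝ) / N - x = (⌊N * x⌋ - N * x) / N := by field_simp
  rw [this, abs_div, abs_of_pos hN]
  gcongr
  rw [abs_le]
  constructor <;> linarith

theorem tendsto_floor_mul_div {ι : Type*} {l : Filter ι} {N : ι → ℝ} (hN : Tendsto N l atTop)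
    (x : ℝ) : Tendsto (fun i => (⌊N i * x⌋ : ℝ) / N i) l (𝓝 x) := by
  rw [tendsto_iff_dist_tendsto_zero]
  refine squeeze_zero' (Eventually.of_forall fun _ => dist_nonneg) ?_
    (tendsto_inv_atTop_zero.comp hN)
  filter_upwards [hN.eventually_gt_atTop 0] with i hi
  simpa [Real.dist_eq] using abs_floor_mul_div_sub_le hi x

/-- A nonzero lattice point is at least half as large in modulus as the points it is the floor
of. -/
theorem abs_le_two_mul_abs_floor_mul_div {N y : ℝ} (hN : 0 < N) (hy : ⌊N * y⌋ ≠ 0) :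
    |y| ≤ 2 * |(⌊N * y⌋ : ℝ) / N| := by
  have h1 := abs_floor_mul_div_sub_le hN y
  have h2 : 1 / N ≤ |(⌊N * y⌋ : ℝ) / N| := by
    rw [abs_div, abs_of_pos hN]
    gcongr
    exact_mod_cast Int.one_le_abs hy
  have h3 := abs_sub_abs_le_abs_sub y ((⌊N * y⌋ : ℝ) / N)
  rw [abs_sub_comm] at h3
  linarith

theorem inv_one_add_sq_le {u v : ℝ} (h : |v - u| ≤ 2) :
    (1 + v ^ 2)⁻¹ ≤ 9 * (1 + u ^ 2)⁻¹ := by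
  have h' := abs_le.1 h
  rw [← div_eq_mul_inv, inv_eq_one_div, div_le_div_iff₀ (by positivity) (by positivity)]
  nlinarith [sq_nonneg (v + (v - u)), mul_nonneg (sub_nonneg.2 h'.1) (sub_nonneg.2 h'.2)]

theorem exists_abs_le_inv_one_add_sq (f : SchwartzMap ℝ ℝ) :
    ∃ C, 0 < C ∧ ∀ x, |f x| ≤ C * (1 + x ^ 2)⁻¹ := by
  obtain ⟨C₀, hC₀, h₀⟩ := f.decay 0 0
  obtain ⟨C₂, hC₂, h₂⟩ := f.decay 2 0
  refine ⟨C₀ + C₂, by positivity, fun x => ?_⟩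
  have h₀ := h₀ x
  have h₂ := h₂ x
  simp only [norm_iteratedFDeriv_zero, Real.norm_eq_abs, pow_zero, one_mul, sq_abs] at h₀ h₂
  rw [← div_eq_mul_inv, le_div_iff₀ (by positivity)]
  linarith

theorem exists_sq_sub_le (H : SchwartzMap ℝ ℝ) :
    ∃ K, 0 < K ∧ (∀ x y, (H (x + y) - H x) ^ 2 ≤ K * ((1 + x ^ 2)⁻¹ + (1 + (x + y) ^ 2)⁻¹)) ∧
      ∀ x y, |y| ≤ 1 → (H (x + y) - H x) ^ 2 ≤ K * (y ^ 2 * (1 + x ^ 2)⁻¹) := by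
  obtain ⟨C, hC, hH⟩ := exists_abs_le_inv_one_add_sq H
  obtain ⟨D, hD, hH'⟩ := exists_abs_le_inv_one_add_sq (SchwartzMap.derivCLM ℝ ℝ H)
  simp only [SchwartzMap.derivCLM_apply] at hH'
  have hw (u : ℝ) : 0 < (1 + u ^ 2)⁻¹ ∧ ((1 + u ^ 2)⁻¹) ^ 2 ≤ (1 + u ^ 2)⁻¹ := by
    have h0 : 0 < (1 + u ^ 2)⁻¹ := by positivity
    have h1 : (1 + u ^ 2)⁻¹ ≤ 1 := inv_le_one_of_one_le₀ (by nlinarith [sq_nonneg u])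
    exact ⟨h0, by nlinarith⟩
  have hsq (u : ℝ) : H u ^ 2 ≤ C ^ 2 * (1 + u ^ 2)⁻¹ := by
    calc H u ^ 2 = |H u| ^ 2 := (sq_abs _).symm
      _ ≤ (C * (1 + u ^ 2)⁻¹) ^ 2 := by gcongr; exact hH u
      _ ≤ _ := by rw [mul_pow]; gcongr; exact (hw u).2
  refine ⟨2 * C ^ 2 + (9 * D) ^ 2, by positivity, fun x y => ?_, fun x y hy => ?_⟩
  · have h1 := hsq x
    have h2 := hsq (x + y)
    have h3 : 0 ≤ (9 * D) ^ 2 * ((1 + x ^ 2)⁻¹ + (1 + (x + y) ^ 2)⁻¹) := by positivity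
    nlinarith [sq_nonneg (H (x + y) + H x)]
  · have hmvt : ‖H (x + y) - H x‖ ≤ 9 * D * (1 + x ^ 2)⁻¹ * ‖x + y - x‖ := by
      refine (convex_Icc (x - 1) (x + 1)).norm_image_sub_le_of_norm_deriv_le
        (fun u _ => H.differentiableAt) (fun u hu => ?_) ?_ ?_
      · refine (hH' u).trans ?_
        have : |u - x| ≤ 2 := abs_le.2 ⟨by linarith [hu.1], by linarith [hu.2]⟩
        nlinarith [inv_one_add_sq_le this]
      · constructor <;> linarith
      · have := abs_le.1 hy
        constructor <;> linarith
    rw [add_sub_cancel_left, Real.norm_eq_abs, Real.norm_eq_abs] at hmvt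
    calc (H (x + y) - H x) ^ 2 = |H (x + y) - H x| ^ 2 := (sq_abs _).symm
      _ ≤ (9 * D * (1 + x ^ 2)⁻¹ * |y|) ^ 2 := by gcongr
      _ = (9 * D) ^ 2 * (y ^ 2 * ((1 + x ^ 2)⁻¹) ^ 2) := by rw [mul_pow, mul_pow, sq_abs]; ring
      _ ≤ (9 * D) ^ 2 * (y ^ 2 * (1 + x ^ 2)⁻¹) := by gcongr; exact (hw x).2
      _ ≤ _ := by gcongr; nlinarith [sq_nonneg C]

/-- The energy density `s y * (H (x + y) - H x) ^ 2` at the point `(x, y)`. -/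
noncomputable def density (α c : ℝ) (H : SchwartzMap ℝ ℝ) (p : ℝ × ℝ) : ℝ :=
  sker α c p.2 * (H (p.1 + p.2) - H p.1) ^ 2

/-- An integrable function dominating, up to a constant, the energy density and its lattice
discretizations. -/
noncomputable def majorant (α : ℝ) (p : ℝ × ℝ) : ℝ :=
  (Set.Icc (-2) 2).indicator (fun y : ℝ => 1 + (|y| / 2) ^ (1 - α)) p.2 * (1 + p.1 ^ 2)⁻¹ +
    (1 + |p.2|) ^ (-(1 + α)) * ((1 + p.1 ^ 2)⁻¹ + (1 + (p.1 + p.2) ^ 2)⁻¹)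

theorem majorant_nonneg (α : ℝ) (p : ℝ × ℝ) : 0 ≤ majorant α p := by
  have : 0 ≤ (Set.Icc (-2) 2).indicator (fun y : ℝ => 1 + (|y| / 2) ^ (1 - α)) p.2 :=
    Set.indicator_nonneg (fun _ _ => by positivity) _
  unfold majorant
  positivity

theorem integrable_majorant {α : ℝ} (hα0 : 0 < α) (hα2 : α < 2) : Integrable (majorant α) := by
  have hw := integrable_inv_one_add_sq
  have hnear : Integrable
      ((Set.Icc (-2) 2).indicator fun y : ℝ => 1 + (|y| / 2) ^ (1 - α)) := by
    rw [integrable_indicator_iff measurableSet_Icc]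
    refine (integrable_const _).add ?_
    have hpos : IntervalIntegrable (fun y : ℝ => (|y| / 2) ^ (1 - α)) volume 0 2 := by
      refine ((intervalIntegral.intervalIntegrable_rpow' (by linarith : -1 < 1 - α)).div_const
        (2 ^ (1 - α))).congr ?_
      intro y hy
      rw [Set.uIoc_of_le zero_le_two] at hy
      simp only
      rw [abs_of_pos hy.1, Real.div_rpow hy.1.le zero_le_two]
    have hneg : IntervalIntegrable (fun y : ℝ => (|y| / 2) ^ (1 - α)) volume (-2) 0 := by
      simpa using ((IntervalIntegrable.iff_comp_neg).1 hpos).symm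
    have := hneg.trans hpos
    rwa [intervalIntegrable_iff_integrableOn_Icc_of_le (by norm_num)] at this
  have hfar : Integrable fun y : ℝ => (1 + |y|) ^ (-(1 + α)) :=
    integrable_one_add_norm (by simpa using hα0)
  have hshear : Integrable fun p : ℝ × ℝ => (1 + |p.2|) ^ (-(1 + α)) * (1 + (p.1 + p.2) ^ 2)⁻¹ := by
    refine ((measurePreserving_prod_add_swap (volume : Measure ℝ)
      (volume : Measure ℝ)).integrable_comp_of_integrable (hfar.mul_prod hw)).congr
      (Eventually.of_forall fun p => ?_)
    simp only [Function.comp_apply, add_comm p.1 p.2]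
  refine (((hw.mul_prod hnear).add ((hw.mul_prod hfar).add hshear))).congr
    (Eventually.of_forall fun p => ?_)
  simp only [majorant, Pi.add_apply]
  ring

theorem density_nonneg {c : ℝ} (hc : 0 < c) (α : ℝ) (H : SchwartzMap ℝ ℝ) (p : ℝ × ℝ) :
    0 ≤ density α c H p := by
  unfold density sker
  positivity

theorem measurable_density (α c : ℝ) (H : SchwartzMap ℝ ℝ) : Measurable (density α c H) := by
  have : Measurable H := H.continuous.measurable
  unfold density sker
  fun_prop

theorem continuousAt_density (α c : ℝ) (H : SchwartzMap ℝ ℝ) {p : ℝ × ℝ} (hp : p.2 ≠ 0) :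
    ContinuousAt (density α c H) p := by
  have hH : Continuous H := H.continuous
  unfold density sker
  refine ContinuousAt.mul (continuousAt_const.mul ?_) (by fun_prop)
  exact ContinuousAt.rpow_const (by fun_prop) (Or.inl (abs_ne_zero.2 hp))

theorem exists_density_le {α c : ℝ} (hα0 : 0 < α) (hc : 0 < c) (H : SchwartzMap ℝ ℝ) :
    ∃ K, 0 < K ∧ ∀ p q : ℝ × ℝ, p.2 ≠ 0 → q.2 ≠ 0 → |p.2| ≤ 2 * |q.2| → |q.1 - p.1| ≤ 1 →
      |q.2 - p.2| ≤ 1 → density α c H q ≤ K * majorant α p := by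
  obtain ⟨K, hK, hfar, hnear⟩ := exists_sq_sub_le H
  refine ⟨9 * K * c * 3 ^ (1 + α), by positivity, ?_⟩
  rintro ⟨x, y⟩ ⟨x', y'⟩ hy hy' hyy' hx hyd
  simp only at hy hy' hyy' hx hyd
  have hone : (1 : ℝ) ≤ 3 ^ (1 + α) := Real.one_le_rpow (by norm_num) (by linarith)
  have hypos : 0 < |y| := abs_pos.2 hy
  have hypos' : 0 < |y'| := abs_pos.2 hy'
  have hwx : (1 + x' ^ 2)⁻¹ ≤ 9 * (1 + x ^ 2)⁻¹ := inv_one_add_sq_le (hx.trans one_le_two)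
  simp only [density, majorant, sker]
  rcases le_or_gt |y'| 1 with h1 | h1
  · have hmem : y ∈ Set.Icc (-2 : ℝ) 2 := by
      have : |y| ≤ 2 := by linarith
      exact abs_le.1 this
    have hpow : |y'| ^ (-(1 + α)) * y' ^ 2 ≤ 1 + (|y| / 2) ^ (1 - α) := by
      have heq : |y'| ^ (-(1 + α)) * y' ^ 2 = |y'| ^ (1 - α) := by
        rw [← sq_abs, ← Real.rpow_natCast |y'| 2, ← Real.rpow_add hypos']
        congr 1
        push_cast
        ring
      rw [heq]
      rcases le_total 0 (1 - α) with h | h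
      · have := Real.rpow_le_one hypos'.le h1 h
        have : 0 ≤ (|y| / 2) ^ (1 - α) := by positivity
        linarith
      · have := Real.rpow_le_rpow_of_nonpos (by positivity : 0 < |y| / 2)
          (by linarith : |y| / 2 ≤ |y'|) h
        linarith
    rw [Set.indicator_of_mem hmem]
    calc c * |y'| ^ (-(1 + α)) * (H (x' + y') - H x') ^ 2
        ≤ c * |y'| ^ (-(1 + α)) * (K * (y' ^ 2 * (1 + x' ^ 2)⁻¹)) := by
          gcongr; exact hnear x' y' h1
      _ = c * K * (|y'| ^ (-(1 + α)) * y' ^ 2) * (1 + x' ^ 2)⁻¹ := by ring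
      _ ≤ c * K * (1 + (|y| / 2) ^ (1 - α)) * (9 * (1 + x ^ 2)⁻¹) := by gcongr
      _ = 9 * K * c * 1 * ((1 + (|y| / 2) ^ (1 - α)) * (1 + x ^ 2)⁻¹ + 0) := by ring
      _ ≤ _ := by gcongr; positivity
  · have hpow : |y'| ^ (-(1 + α)) ≤ 3 ^ (1 + α) * (1 + |y|) ^ (-(1 + α)) := by
      have := Real.rpow_le_rpow_of_nonpos (by positivity : 0 < (1 + |y|) / 3)
        (by linarith : (1 + |y|) / 3 ≤ |y'|) (by linarith : -(1 + α) ≤ 0)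
      rwa [Real.div_rpow (by positivity) (by norm_num), Real.rpow_neg (by norm_num : (0:ℝ) ≤ 3),
        div_inv_eq_mul, mul_comm] at this
    have hwxy : (1 + (x' + y') ^ 2)⁻¹ ≤ 9 * (1 + (x + y) ^ 2)⁻¹ := by
      refine inv_one_add_sq_le ?_
      have := abs_add_le (x' - x) (y' - y)
      rw [show x' + y' - (x + y) = x' - x + (y' - y) by ring]
      linarith
    have hind : 0 ≤ (Set.Icc (-2) 2).indicator (fun y : ℝ => 1 + (|y| / 2) ^ (1 - α)) y :=
      Set.indicator_nonneg (fun _ _ => by positivity) _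
    calc c * |y'| ^ (-(1 + α)) * (H (x' + y') - H x') ^ 2
        ≤ c * (3 ^ (1 + α) * (1 + |y|) ^ (-(1 + α))) *
            (K * (9 * (1 + x ^ 2)⁻¹ + 9 * (1 + (x + y) ^ 2)⁻¹)) := by
          gcongr
          exact (hfar x' y').trans (by gcongr)
      _ = 9 * K * c * 3 ^ (1 + α) *
            (0 + (1 + |y|) ^ (-(1 + α)) * ((1 + x ^ 2)⁻¹ + (1 + (x + y) ^ 2)⁻¹)) := by ring
      _ ≤ _ := by gcongr; positivity

/-- The nearest lattice point of `N⁻¹ ℤ × N⁻¹ ℤ` below and to the left. -/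
noncomputable def latticeFloor (N : ℝ) (p : ℝ × ℝ) : ℝ × ℝ :=
  (⌊N * p.1⌋ / N, ⌊N * p.2⌋ / N)

theorem measurable_latticeFloor (N : ℝ) : Measurable (latticeFloor N) := by
  unfold latticeFloor
  have h : Measurable fun k : ℤ => (k : ℝ) := measurable_from_top
  exact ((h.comp (Int.measurable_floor.comp (by fun_prop))).div_const N).prodMk
    ((h.comp (Int.measurable_floor.comp (by fun_prop))).div_const N)

theorem sker_zero {α : ℝ} (hα0 : 0 < α) (c : ℝ) : sker α c 0 = 0 := by
  rw [sker, abs_zero, Real.zero_rpow (by linarith), mul_zero]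

theorem ae_snd_ne_zero : ∀ᵐ p : ℝ × ℝ, p.2 ≠ 0 :=
  (Measure.quasiMeasurePreserving_snd (μ := (volume : Measure ℝ)) (ν := (volume : Measure ℝ))).ae
    (Measure.ae_ne volume 0)

theorem exists_ae_density_latticeFloor_le {α c : ℝ} (hα0 : 0 < α) (hc : 0 < c)
    (H : SchwartzMap ℝ ℝ) :
    ∃ K, 0 < K ∧ (∀ᵐ p, ‖density α c H p‖ ≤ K * majorant α p) ∧
      ∀ N : ℝ, 1 ≤ N → ∀ᵐ p, ‖density α c H (latticeFloor N p)‖ ≤ K * majorant α p := by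
  obtain ⟨K, hK, hle⟩ := exists_density_le hα0 hc H
  refine ⟨K, hK, ?_, fun N hN => ?_⟩
  · filter_upwards [ae_snd_ne_zero] with p hp
    rw [Real.norm_of_nonneg (density_nonneg hc α H p)]
    exact hle p p hp hp (by linarith [abs_nonneg p.2]) (by simp) (by simp)
  · filter_upwards [ae_snd_ne_zero] with p hp
    rw [Real.norm_of_nonneg (density_nonneg hc α H _)]
    have hN0 : 0 < N := by linarith
    have hN1 : 1 / N ≤ 1 := by rwa [div_le_one hN0]
    by_cases h : ⌊N * p.2⌋ = 0
    · have : density α c H (latticeFloor N p) = 0 := by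
        simp [density, latticeFloor, h, sker_zero hα0]
      rw [this]
      exact mul_nonneg hK.le (majorant_nonneg α p)
    · refine hle p (latticeFloor N p) hp ?_ (abs_le_two_mul_abs_floor_mul_div hN0 h)
        ((abs_floor_mul_div_sub_le hN0 _).trans hN1) ((abs_floor_mul_div_sub_le hN0 _).trans hN1)
      exact div_ne_zero (Int.cast_ne_zero.2 h) hN0.ne'

theorem discrete_energy_eq_integral {α : ℝ} (hα0 : 0 < α) (c : ℝ) (H : SchwartzMap ℝ ℝ) {N : ℝ}
    (hN : 0 < N) :
    (1 / N ^ 2) * ∑' x : ℤ, ∑' y : {y : ℤ // y ≠ 0}, sker α c (((y : ℤ) : ℝ) / N) *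
        (H (((x + (y : ℤ) : ℤ) : ℝ) / N) - H ((x : ℝ) / N)) ^ 2 =
      ∫ x : ℝ, ∫ y : ℝ, density α c H (latticeFloor N (x, y)) := by
  have hsub (x : ℤ) : ∑' y : {y : ℤ // y ≠ 0}, sker α c (((y : ℤ) : ℝ) / N) *
      (H (((x + (y : ℤ) : ℤ) : ℝ) / N) - H ((x : ℝ) / N)) ^ 2 =
      ∑' y : ℤ, density α c H ((x : ℝ) / N, (y : ℝ) / N) := by
    have h := tsum_subtype_eq_of_support_subset
      (f := fun y : ℤ => density α c H ((x : ℝ) / N, (y : ℝ) / N)) (s := {y | y ≠ 0}) (by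
        intro y hy h0
        apply hy
        simp [density, h0, sker_zero hα0])
    rw [← h]
    refine tsum_congr fun y => ?_
    simp only [density, Int.cast_add, add_div]
  simp only [hsub, latticeFloor]
  simp_rw [fun x : ℝ => integral_comp_floor_mul
    (fun k : ℤ => density α c H ((⌊N * x⌋ : ℝ) / N, (k : ℝ) / N)) hN]
  rw [integral_comp_floor_mul
    (fun j : ℤ => N⁻¹ * ∑' k : ℤ, density α c H ((j : ℝ) / N, (k : ℝ) / N)) hN, tsum_mul_left]
  field_simp

theorem tendsto_integral_density_latticeFloor {α c : ℝ} (hα0 : 0 < α) (hα2 : α < 2) (hc : 0 < c)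
    (H : SchwartzMap ℝ ℝ) {N : ℕ → ℝ} (hN : Tendsto N atTop atTop) :
    Tendsto (fun n => ∫ x : ℝ, ∫ y : ℝ, density α c H (latticeFloor (N n) (x, y))) atTop
      (𝓝 (∫ x : ℝ, ∫ y : ℝ, density α c H (x, y))) := by
  obtain ⟨K, hK, hlim, hdisc⟩ := exists_ae_density_latticeFloor_le hα0 hc H
  have hG : Integrable fun p => K * majorant α p := (integrable_majorant hα0 hα2).const_mul K
  have hmeas (M : ℝ) : AEStronglyMeasurable (fun p => density α c H (latticeFloor M p)) :=
    ((measurable_density α c H).comp (measurable_latticeFloor M)).aestronglyMeasurable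
  have hint : Integrable (density α c H) :=
    hG.mono' (measurable_density α c H).aestronglyMeasurable hlim
  rw [← integral_prod _ hint]
  refine Tendsto.congr' (f₁ := fun n => ∫ p, density α c H (latticeFloor (N n) p)) ?_ ?_
  · filter_upwards [hN.eventually_ge_atTop 1] with n hn
    exact integral_prod _ (hG.mono' (hmeas _) (hdisc _ hn))
  · refine tendsto_integral_filter_of_dominated_convergence _
      (Eventually.of_forall fun n => hmeas _) ?_ hG ?_
    · filter_upwards [hN.eventually_ge_atTop 1] with n hn using hdisc _ hn
    · filter_upwards [ae_snd_ne_zero] with p hp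
      exact (continuousAt_density α c H hp).tendsto.comp
        ((tendsto_floor_mul_div hN p.1).prodMk_nhds (tendsto_floor_mul_div hN p.2))

end FractionalDirichlet

/-- convergence of the discrete fractional Dirichlet energy to its
continuum counterpart:
`(1/n^{2/α}) ∑_{x∈ℤ} ∑_{y∈ℤ∖{0}} s(y/n^{1/α}) (H((x+y)/n^{1/α}) − H(x/n^{1/α}))²`
tends to `∫∫ s(y)(H(x+y) − H(x))² dy dx` as `n → ∞`. -/
theorem discrete_dirichlet_energy_convergence
    (α c : ℝ) (hα0 : 0 < α) (hα2 : α < 2) (hc : 0 < c)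
    (H : SchwartzMap ℝ ℝ) :
    Filter.Tendsto (fun n : ℕ =>
        (1 / (n : ℝ) ^ (2 / α)) *
          ∑' x : ℤ, ∑' y : {y : ℤ // y ≠ 0},
            sker α c (((y : ℤ) : ℝ) / (n : ℝ) ^ (1 / α)) *
              (H (((x + (y : ℤ) : ℤ) : ℝ) / (n : ℝ) ^ (1 / α)) -
                H ((x : ℝ) / (n : ℝ) ^ (1 / α))) ^ 2)
      Filter.atTop
      (nhds (∫ x : ℝ, ∫ y : ℝ, sker α c y * (H (x + y) - H x) ^ 2)) := by
  have hN : Filter.Tendsto (fun n : ℕ => (n : ℝ) ^ (1 / α)) Filter.atTop Filter.atTop :=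
    (tendsto_rpow_atTop (by positivity)).comp tendsto_natCast_atTop_atTop
  refine (FractionalDirichlet.tendsto_integral_density_latticeFloor hα0 hα2 hc H hN).congr' ?_
  filter_upwards [hN.eventually_gt_atTop 0] with n hn
  rw [← FractionalDirichlet.discrete_energy_eq_integral hα0 c H hn, ← Real.rpow_natCast,
    ← Real.rpow_mul n.cast_nonneg]
  norm_num [div_eq_inv_mul, mul_comm]
end
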